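/- arXiv:1206.2631 — 4 statements merged into one kernel-verified Lean document; each statement's English description precedes it below -/
import Mathlib

section
/- Let G be a group acting on a G-tree T such that every vertex stabilizer G_v satisfies Fcd G_v ≤ n for a fixed integer n ≥ 0. Then Fcd G ≤ n + 1. -/
open CategoryTheory

/-- The permutation `ℤG`-module `ℤ[Δ]` on a `G`-set `Δ`. -/
noncomputable def permMod (G : Type) [Group G] (Δ : Type) [MulAction G Δ] :
    ModuleCat (MonoidAlgebra ℤ G) :=
  ModuleCat.of _ (Representation.ofMulAction ℤ G Δ).asModule

/-- The trivial `ℤG`-module `ℤ`. -/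
noncomputable def trivialZModule (G : Type) [Group G] : ModuleCat (MonoidAlgebra ℤ G) :=
  ModuleCat.of _ (Representation.trivial ℤ (G := G) (V := ℤ)).asModule

/-- Restriction of `ℤG`-modules to `ℤK`-modules along a subgroup `K ≤ G`. -/
noncomputable def resToSubgroup (G : Type) [Group G] (K : Subgroup G) :
    ModuleCat (MonoidAlgebra ℤ G) ⥤ ModuleCat (MonoidAlgebra ℤ ↥K) :=
  ModuleCat.restrictScalars (MonoidAlgebra.mapDomainRingHom ℤ K.subtype)

/-- A resolution `0 → C_n → ⋯ → C_0 → ℤ → 0` of the trivial `ℤG`-module `ℤ` by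
permutation modules `C_i = ℤ[Δ_i]` on `G`-sets with finite stabilizers, which is
split exact (admits a chain contraction) upon restriction to every finite subgroup
`K ≤ G`. -/
structure FResolution (G : Type) [Group G] (n : ℕ) where
  Δ : ℕ → Type
  [act : ∀ i, MulAction G (Δ i)]
  finite_stabilizers : ∀ (i : ℕ) (x : Δ i), Finite (MulAction.stabilizer G x)
  empty_above : ∀ i : ℕ, n < i → IsEmpty (Δ i)
  d : ∀ i : ℕ, permMod G (Δ (i + 1)) ⟶ permMod G (Δ i)
  ε : permMod G (Δ 0) ⟶ trivialZModule G
  eps_surjective : Function.Surjective ε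
  exact_zero : Function.Exact (d 0) ε
  exact_succ : ∀ i : ℕ, Function.Exact (d (i + 1)) (d i)
  split : ∀ K : Subgroup G, Finite K →
    ∃ (s : ∀ i : ℕ, (resToSubgroup G K).obj (permMod G (Δ i)) ⟶
          (resToSubgroup G K).obj (permMod G (Δ (i + 1))))
      (σ : (resToSubgroup G K).obj (trivialZModule G) ⟶
          (resToSubgroup G K).obj (permMod G (Δ 0))),
      σ ≫ (resToSubgroup G K).map ε = 𝟙 _ ∧
      (resToSubgroup G K).map ε ≫ σ + s 0 ≫ (resToSubgroup G K).map (d 0) = 𝟙 _ ∧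
      ∀ i : ℕ, (resToSubgroup G K).map (d i) ≫ s i +
        s (i + 1) ≫ (resToSubgroup G K).map (d (i + 1)) = 𝟙 _

/-- `Fcd G ≤ n`. -/
def FcdLE (G : Type) [Group G] (n : ℕ) : Prop := Nonempty (FResolution G n)

/-- The `F`-cohomological dimension `Fcd G ∈ ℕ∞`. -/
noncomputable def fCd (G : Type) [Group G] : ℕ∞ :=
  sInf {c : ℕ∞ | ∃ n : ℕ, c = n ∧ FcdLE G n}

/-- A `G`-tree: an action of `G` on the vertices of a tree by graph automorphisms,
without inversions. -/
structure IsGTree (G : Type) [Group G] (V : Type) [MulAction G V] (T : SimpleGraph V) : Prop where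
  isTree : T.IsTree
  adj_smul : ∀ (g : G) (u v : V), T.Adj u v → T.Adj (g • u) (g • v)
  no_inversion : ∀ (g : G) (u v : V), T.Adj u v → ¬(g • u = v ∧ g • v = u)

section Transfer

/-- The linear action of `g` on the free abelian group on a `G`-set. -/
noncomputable def permAct {G Δ : Type} [Group G] [MulAction G Δ] (g : G) :
    (Δ →₀ ℤ) →ₗ[ℤ] (Δ →₀ ℤ) :=
  Finsupp.lmapDomain ℤ ℤ (g • ·)

variable {G Δ Δ' : Type} [Group G] [MulAction G Δ] [MulAction G Δ']

@[simp] lemma permAct_single (g : G) (x : Δ) (n : ℤ) :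
    permAct g (Finsupp.single x n) = Finsupp.single (g • x) n := by
  simp [permAct]

@[simp] lemma permAct_one (z : Δ →₀ ℤ) : permAct (1 : G) z = z := by
  have h : ((1 : G) • · : Δ → Δ) = id := funext fun x => one_smul G x
  rw [permAct, h]
  simp

lemma permAct_mul (g h : G) (z : Δ →₀ ℤ) : permAct (g * h) z = permAct g (permAct h z) := by
  simp [permAct, ← Finsupp.mapDomain_comp, Function.comp_def, mul_smul]

/-- An additive map between modules over an integral group ring is linear as soon as it commutes
with the group elements. -/
noncomputable def linearOfCommutes {M N : Type} [AddCommGroup M] [AddCommGroup N]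
    [Module (MonoidAlgebra ℤ G) M] [Module (MonoidAlgebra ℤ G) N] (f : M →+ N)
    (hf : ∀ (g : G) (x : M),
      f (MonoidAlgebra.single g (1 : ℤ) • x) = MonoidAlgebra.single g (1 : ℤ) • f x) :
    M →ₗ[MonoidAlgebra ℤ G] N where
  toFun := f
  map_add' := f.map_add
  map_smul' r x := by
    dsimp only [RingHom.id_apply]
    induction r using MonoidAlgebra.induction_on with
    | of g => exact hf g x
    | add a b ha hb => rw [add_smul, map_add, ha, hb, add_smul]
    | smul n a ha => rw [smul_assoc, map_zsmul, ha, smul_assoc]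

/-- The free abelian group underlying a permutation module. -/
noncomputable def permModEquiv (G Δ : Type) [Group G] [MulAction G Δ] :
    permMod G Δ ≃+ (Δ →₀ ℤ) :=
  (((Representation.ofMulAction ℤ G Δ).asModuleEquiv).trans
    (MonoidAlgebra.coeffLinearEquiv ℤ)).toAddEquiv

lemma permModEquiv_smul (g : G) (x : permMod G Δ) :
    permModEquiv G Δ (MonoidAlgebra.single g (1 : ℤ) • x) = permAct g (permModEquiv G Δ x) := by
  have := (Representation.ofMulAction ℤ G Δ).asModuleEquiv_map_smul (MonoidAlgebra.single g 1) x
  rw [Representation.asAlgebraHom_single, one_smul, Representation.ofMulAction_def] at this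
  exact congrArg (MonoidAlgebra.coeffLinearEquiv ℤ) this

lemma permModEquiv_symm_smul (g : G) (x : Δ →₀ ℤ) :
    (permModEquiv G Δ).symm (permAct g x) =
      MonoidAlgebra.single g (1 : ℤ) • (permModEquiv G Δ).symm x := by
  rw [AddEquiv.symm_apply_eq, permModEquiv_smul, AddEquiv.apply_symm_apply]

/-- The abelian group underlying the trivial module. -/
noncomputable def trivialEquiv (G : Type) [Group G] : trivialZModule G ≃+ ℤ :=
  (Representation.trivial ℤ (G := G) (V := ℤ)).asModuleEquiv.toAddEquiv

lemma trivialEquiv_smul (g : G) (x : trivialZModule G) :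
    trivialEquiv G (MonoidAlgebra.single g (1 : ℤ) • x) = trivialEquiv G x := by
  have := (Representation.trivial ℤ (G := G) (V := ℤ)).asModuleEquiv_map_smul
    (MonoidAlgebra.single g 1) x
  rwa [Representation.asAlgebraHom_single, one_smul] at this

lemma trivial_smul (g : G) (x : trivialZModule G) :
    (MonoidAlgebra.single g (1 : ℤ) • x) = x :=
  (trivialEquiv G).injective (trivialEquiv_smul g x)

/-- Restriction to a subgroup does not change the underlying abelian group. -/
noncomputable def resEquiv (K : Subgroup G) (M : ModuleCat (MonoidAlgebra ℤ G)) :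
    (resToSubgroup G K).obj M ≃+ M where
  toFun x := x
  invFun x := x
  left_inv _ := rfl
  right_inv _ := rfl
  map_add' _ _ := rfl

lemma resEquiv_smul (K : Subgroup G) (M : ModuleCat (MonoidAlgebra ℤ G)) (k : K)
    (x : (resToSubgroup G K).obj M) :
    resEquiv K M (MonoidAlgebra.single k (1 : ℤ) • x) =
      MonoidAlgebra.single (k : G) (1 : ℤ) • resEquiv K M x := by
  change (MonoidAlgebra.mapDomainRingHom ℤ K.subtype (MonoidAlgebra.single k (1 : ℤ))) •
    resEquiv K M x = _
  simp

/-- A `ℤK`-linear map between restrictions from an additive map commuting with `K`. -/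
noncomputable def resHomOfCommutes (K : Subgroup G) {M N : ModuleCat (MonoidAlgebra ℤ G)}
    (f : M →+ N) (hf : ∀ k ∈ K, ∀ x : M,
      f (MonoidAlgebra.single k (1 : ℤ) • x) = MonoidAlgebra.single k (1 : ℤ) • f x) :
    (resToSubgroup G K).obj M ⟶ (resToSubgroup G K).obj N :=
  ModuleCat.ofHom (X := (resToSubgroup G K).obj M) (Y := (resToSubgroup G K).obj N)
    (linearOfCommutes
      (((resEquiv K N).symm.toAddMonoidHom.comp f).comp (resEquiv K M).toAddMonoidHom)
      fun k x => (resEquiv K N).injective <|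
        ((congrArg f (resEquiv_smul K M k x)).trans (hf k k.2 _)).trans
          (resEquiv_smul K N k _).symm)

lemma resEquiv_map (K : Subgroup G) {M N : ModuleCat (MonoidAlgebra ℤ G)} (f : M ⟶ N)
    (x : (resToSubgroup G K).obj M) :
    resEquiv K N ((resToSubgroup G K).map f x) = f (resEquiv K M x) := rfl

lemma resEquiv_hom_smul (K : Subgroup G) {M N : ModuleCat (MonoidAlgebra ℤ G)}
    (s : (resToSubgroup G K).obj M ⟶ (resToSubgroup G K).obj N) (k : G) (hk : k ∈ K) (x : M) :
    resEquiv K N (s ((resEquiv K M).symm (MonoidAlgebra.single k (1 : ℤ) • x))) =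
      MonoidAlgebra.single k (1 : ℤ) • resEquiv K N (s ((resEquiv K M).symm x)) := by
  have h : (resEquiv K M).symm (MonoidAlgebra.single k (1 : ℤ) • x) =
      MonoidAlgebra.single (⟨k, hk⟩ : K) (1 : ℤ) • (resEquiv K M).symm x := by
    rw [AddEquiv.symm_apply_eq, resEquiv_smul, AddEquiv.apply_symm_apply]
  rw [h, map_smul, resEquiv_smul]

/-- The linear map on free abelian groups underlying a map of permutation modules. -/
noncomputable def permHomToLinear (f : permMod G Δ ⟶ permMod G Δ') :
    (Δ →₀ ℤ) →ₗ[ℤ] (Δ' →₀ ℤ) :=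
  (((permModEquiv G Δ').toAddMonoidHom.comp f.hom.toAddMonoidHom).comp
    (permModEquiv G Δ).symm.toAddMonoidHom).toIntLinearMap

lemma permHomToLinear_apply (f : permMod G Δ ⟶ permMod G Δ') (z : Δ →₀ ℤ) :
    permHomToLinear f z = permModEquiv G Δ' (f ((permModEquiv G Δ).symm z)) := rfl

lemma permHomToLinear_permAct (f : permMod G Δ ⟶ permMod G Δ') (g : G) (z : Δ →₀ ℤ) :
    permHomToLinear f (permAct g z) = permAct g (permHomToLinear f z) := by
  rw [permHomToLinear_apply, permModEquiv_symm_smul, map_smul, permModEquiv_smul,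
    permHomToLinear_apply]

/-- A map of permutation modules from an equivariant linear map of free abelian groups. -/
noncomputable def permHomOfLinear (f : (Δ →₀ ℤ) →ₗ[ℤ] (Δ' →₀ ℤ))
    (hf : ∀ (g : G) (z : Δ →₀ ℤ), f (permAct g z) = permAct g (f z)) :
    permMod G Δ ⟶ permMod G Δ' :=
  ModuleCat.ofHom (X := permMod G Δ) (Y := permMod G Δ') (linearOfCommutes
    (((permModEquiv G Δ').symm.toAddMonoidHom.comp f.toAddMonoidHom).comp
      (permModEquiv G Δ).toAddMonoidHom)
    fun g x => ((congrArg (fun y => (permModEquiv G Δ').symm (f y))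
      (permModEquiv_smul g x)).trans (congrArg _ (hf g _))).trans (permModEquiv_symm_smul g _))

lemma permHomOfLinear_apply (f : (Δ →₀ ℤ) →ₗ[ℤ] (Δ' →₀ ℤ))
    (hf : ∀ (g : G) (z : Δ →₀ ℤ), f (permAct g z) = permAct g (f z)) (x : permMod G Δ) :
    permHomOfLinear f hf x = (permModEquiv G Δ').symm (f (permModEquiv G Δ x)) := rfl

end Transfer

section Lifting

/-- Equivariant choice: a relation between two `K`-sets that admits, at each point, a value fixed
by the stabilizer of that point contains the graph of an equivariant map. -/
lemma exists_equivariant_choice {G X Y : Type} [Group G] [MulAction G X] [MulAction G Y]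
    (Q : X → Y → Prop) (hQ : ∀ (g : G) x y, Q x y → Q (g • x) (g • y))
    (h : ∀ x, ∃ y, Q x y ∧ ∀ g : G, g • x = x → g • y = y) :
    ∃ f : X → Y, (∀ (g : G) x, f (g • x) = g • f x) ∧ ∀ x, Q x (f x) := by
  choose y hy hfix using h
  let r : X → X := fun x => (Quotient.mk (MulAction.orbitRel G X) x).out
  have hr : ∀ x, ∃ g : G, g • r x = x := fun x =>
    MulAction.orbitRel_apply.1 ((MulAction.orbitRel G X).symm (Quotient.mk_out x))
  have hrg : ∀ (g : G) x, r (g • x) = r x := fun g x =>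
    congrArg Quotient.out (Quotient.sound ⟨g, rfl⟩)
  choose c hc using hr
  refine ⟨fun x => c x • y (r x), fun g x => ?_, fun x => ?_⟩
  · have : ((c (g • x))⁻¹ * (g * c x)) • r x = r x := by
      rw [mul_smul, mul_smul, hc, inv_smul_eq_iff]
      conv_rhs => rw [← hrg g x, hc]
    have h2 := hfix _ _ this
    rw [mul_smul, inv_smul_eq_iff, mul_smul] at h2
    simp only [hrg, h2]
  · have := hQ (c x) _ _ (hy (r x))
    rwa [hc] at this

variable {G X Y Z : Type} [Group G] [MulAction G X] [MulAction G Y] [MulAction G Z]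

/-- The action on the free abelian group, as a multiplicative action. -/
noncomputable abbrev permMulAction (G Y : Type) [Group G] [MulAction G Y] :
    MulAction G (Y →₀ ℤ) where
  smul g z := permAct g z
  one_smul := permAct_one
  mul_smul := permAct_mul

/-- Equivariant choice with values in a permutation module, for the action of a subgroup. -/
lemma exists_permAct_equivariant_choice (K : Subgroup G) (Q : X → (Y →₀ ℤ) → Prop)
    (hQ : ∀ g ∈ K, ∀ x y, Q x y → Q (g • x) (permAct g y))
    (h : ∀ x, ∃ y, Q x y ∧ ∀ g ∈ K, g • x = x → permAct g y = y) :
    ∃ f : X → (Y →₀ ℤ), (∀ g ∈ K, ∀ x, f (g • x) = permAct g (f x)) ∧ ∀ x, Q x (f x) := by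
  let _ := permMulAction G Y
  obtain ⟨f, hf, hQf⟩ := exists_equivariant_choice (G := K) Q (fun g => hQ g g.2) fun x => by
    obtain ⟨y, hy, hfix⟩ := h x
    exact ⟨y, hy, fun g hg => hfix g g.2 hg⟩
  exact ⟨f, fun g hg => hf ⟨g, hg⟩, hQf⟩

/-- Two linear maps with values in a free abelian group on a `G`-set are intertwined by `g` as soon
as they are on basis elements. -/
lemma map_permAct_of_single (f : (X →₀ ℤ) →ₗ[ℤ] (Y →₀ ℤ)) (g : G)
    (h : ∀ x, f (Finsupp.single (g • x) 1) = permAct g (f (Finsupp.single x 1)))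
    (z : X →₀ ℤ) : f (permAct g z) = permAct g (f z) := by
  have : f ∘ₗ permAct g = permAct g ∘ₗ f := by
    ext1 x
    ext1
    simp [h]
  exact LinearMap.congr_fun this z

/-- Relative projectivity of permutation modules: an equivariant map lifts along `d` when the
images of the basis elements have preimages fixed by the stabilizers. -/
lemma exists_equivariant_lift (K : Subgroup G) (φ : (X →₀ ℤ) →ₗ[ℤ] (Z →₀ ℤ))
    (hφ : ∀ g ∈ K, ∀ z, φ (permAct g z) = permAct g (φ z))
    (d : (Y →₀ ℤ) →ₗ[ℤ] (Z →₀ ℤ)) (hd : ∀ (g : G) z, d (permAct g z) = permAct g (d z))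
    (h : ∀ x : X, ∃ w, d w = φ (Finsupp.single x 1) ∧
      ∀ g ∈ K ⊓ MulAction.stabilizer G x, permAct g w = w) :
    ∃ ψ : (X →₀ ℤ) →ₗ[ℤ] (Y →₀ ℤ),
      (∀ g ∈ K, ∀ z, ψ (permAct g z) = permAct g (ψ z)) ∧ ∀ z, d (ψ z) = φ z := by
  obtain ⟨f, hf, hQ⟩ := exists_permAct_equivariant_choice (X := X) (Y := Y) K
    (fun x y => d y = φ (Finsupp.single x 1))
    (fun g hg x y hy => by rw [hd, hy, ← hφ g hg, permAct_single])
    fun x => by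
      obtain ⟨w, hw, hfix⟩ := h x
      exact ⟨w, hw, fun g hg hgx => hfix g ⟨hg, hgx⟩⟩
  refine ⟨Finsupp.linearCombination ℤ f, fun g hg => map_permAct_of_single _ g fun x => ?_, ?_⟩
  · simp [hf g hg]
  · refine LinearMap.congr_fun (f := d ∘ₗ Finsupp.linearCombination ℤ f) (g := φ) ?_
    ext1 x
    ext1
    simp [hQ]

/-- Dependent recursion with an invariant. -/
lemma exists_seq_of_step {α : ℕ → Type} (P : ∀ i, α i → Prop) (R : ∀ i, α i → α (i + 1) → Prop)
    (a : α 0) (ha : P 0 a) (step : ∀ i x, P i x → ∃ y, P (i + 1) y ∧ R i x y) :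
    ∃ f : ∀ i, α i, f 0 = a ∧ ∀ i, P i (f i) ∧ R i (f i) (f (i + 1)) := by
  choose next hP hR using step
  let F : ∀ i, {x : α i // P i x} := fun i =>
    Nat.rec ⟨a, ha⟩ (fun i x => ⟨next i x.1 x.2, hP i x.1 x.2⟩) i
  exact ⟨fun i => (F i).1, rfl, fun i => ⟨(F i).2, hR i _ (F i).2⟩⟩

end Lifting

/-- An augmented sequence `⋯ → ℤ[Δ 2] → ℤ[Δ 1] → ℤ[Δ 0] → 0` of permutation modules, with finite
stabilizers in positive degrees, whose fixed points under every finite subgroup form an exact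
sequence. -/
structure PermSeq (G : Type) [Group G] where
  Δ : ℕ → Type
  [act : ∀ i, MulAction G (Δ i)]
  d : ∀ i, (Δ (i + 1) →₀ ℤ) →ₗ[ℤ] (Δ i →₀ ℤ)
  map_permAct : ∀ i (g : G) z, d i (permAct g z) = permAct g (d i z)
  d_comp : ∀ i z, d i (d (i + 1) z) = 0
  finite_stabilizer : ∀ i (x : Δ (i + 1)), Finite (MulAction.stabilizer G x)
  exact_zero : ∀ L : Subgroup G, Finite L → ∀ z, (∀ g ∈ L, permAct g z = z) →
    ∃ w, d 0 w = z ∧ ∀ g ∈ L, permAct g w = w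
  exact_succ : ∀ i, ∀ L : Subgroup G, Finite L → ∀ z, (∀ g ∈ L, permAct g z = z) → d i z = 0 →
    ∃ w, d (i + 1) w = z ∧ ∀ g ∈ L, permAct g w = w

namespace PermSeq

attribute [instance] PermSeq.act

variable {G : Type} [Group G]

/-- The sequence has at most `n + 1` non-zero terms in positive degrees. -/
def LengthLE (P : PermSeq G) (n : ℕ) : Prop := ∀ i, n < i → IsEmpty (P.Δ (i + 1))

/-- Over a finite subgroup, the sequence has an equivariant contraction. -/
lemma exists_contraction (P : PermSeq G) (K : Subgroup G) (hK : Finite K) :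
    ∃ t : ∀ i, (P.Δ i →₀ ℤ) →ₗ[ℤ] (P.Δ (i + 1) →₀ ℤ),
      (∀ i, ∀ g ∈ K, ∀ z, t i (permAct g z) = permAct g (t i z)) ∧
      (∀ z, P.d 0 (t 0 z) = z) ∧
      ∀ i z, t i (P.d i z) + P.d (i + 1) (t (i + 1) z) = z := by
  have hfin : ∀ H : Subgroup G, Finite ↥(K ⊓ H) := fun H =>
    Finite.of_injective _ (Subgroup.inclusion_injective (inf_le_left : K ⊓ H ≤ K))
  obtain ⟨t₀, ht₀, hdt₀⟩ := exists_equivariant_lift (X := P.Δ 0) K LinearMap.id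
    (fun _ _ _ => rfl) (P.d 0) (P.map_permAct 0) fun x =>
      P.exact_zero _ (hfin _) _ fun g hg => by
        have : g • x = x := hg.2
        simp [this]
  obtain ⟨t, ht, h⟩ := exists_seq_of_step
    (fun i (s : (P.Δ i →₀ ℤ) →ₗ[ℤ] (P.Δ (i + 1) →₀ ℤ)) =>
      (∀ g ∈ K, ∀ z, s (permAct g z) = permAct g (s z)) ∧ ∀ z, P.d i (s (P.d i z)) = P.d i z)
    (fun i s s' => ∀ z, s (P.d i z) + P.d (i + 1) (s' z) = z)
    t₀ ⟨ht₀, fun z => hdt₀ _⟩ (by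
      rintro i s ⟨hs, hds⟩
      obtain ⟨φ, hφd⟩ : ∃ φ : (P.Δ (i + 1) →₀ ℤ) →ₗ[ℤ] (P.Δ (i + 1) →₀ ℤ),
          ∀ z, φ z = z - s (P.d i z) := ⟨LinearMap.id - s ∘ₗ P.d i, fun _ => rfl⟩
      have hφ : ∀ g ∈ K, ∀ z, φ (permAct g z) = permAct g (φ z) := fun g hg z => by
        simp [hφd, P.map_permAct, hs g hg]
      obtain ⟨s', hs', hds'⟩ := exists_equivariant_lift (X := P.Δ (i + 1)) K φ hφ
        (P.d (i + 1)) (P.map_permAct (i + 1)) fun x =>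
          P.exact_succ i _ (hfin _) _ (fun g hg => by
            have : g • x = x := hg.2
            rw [← hφ g hg.1, permAct_single, this]) (by simp [hφd, hds])
      refine ⟨s', ⟨hs', fun z => ?_⟩, fun z => ?_⟩
      · simp [hds', hφd, P.d_comp]
      · simp [hds', hφd])
  refine ⟨t, fun i => (h i).1.1, fun z => ?_, fun i => (h i).2⟩
  rw [ht, hdt₀]
  rfl

/-- A morphism in degree zero extends to a chain map. -/
lemma exists_chainMap (A B : PermSeq G) (φ : (A.Δ 0 →₀ ℤ) →ₗ[ℤ] (B.Δ 0 →₀ ℤ))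
    (hφ : ∀ (g : G) z, φ (permAct g z) = permAct g (φ z)) :
    ∃ f : ∀ i, (A.Δ i →₀ ℤ) →ₗ[ℤ] (B.Δ i →₀ ℤ), f 0 = φ ∧
      (∀ i (g : G) z, f i (permAct g z) = permAct g (f i z)) ∧
      ∀ i z, B.d i (f (i + 1) z) = f i (A.d i z) := by
  obtain ⟨f, hf, h⟩ := exists_seq_of_step
    (fun i (s : (A.Δ i →₀ ℤ) →ₗ[ℤ] (B.Δ i →₀ ℤ)) =>
      (∀ (g : G) z, s (permAct g z) = permAct g (s z)) ∧
      ∀ x : A.Δ (i + 1), ∃ w, B.d i w = s (A.d i (Finsupp.single x 1)) ∧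
        ∀ g ∈ MulAction.stabilizer G x, permAct g w = w)
    (fun i s s' => ∀ z, B.d i (s' z) = s (A.d i z))
    φ ⟨hφ, fun x => B.exact_zero _ (A.finite_stabilizer 0 x) _ fun g hg => by
      have : g • x = x := hg
      rw [← hφ, ← A.map_permAct, permAct_single, this]⟩ (by
      rintro i s ⟨hs, hds⟩
      obtain ⟨s', hs', hds'⟩ := exists_equivariant_lift (X := A.Δ (i + 1)) ⊤
        (s ∘ₗ A.d i) (fun g _ z => by simp [hs, A.map_permAct]) (B.d i) (B.map_permAct i)
        fun x => by simpa using hds x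
      refine ⟨s', ⟨fun g => hs' g trivial, fun x => ?_⟩, hds'⟩
      refine B.exact_succ i _ (A.finite_stabilizer (i + 1) x) _ (fun g hg => ?_) ?_
      · have : g • x = x := hg
        rw [← hs' g trivial, ← A.map_permAct, permAct_single, this]
      · simp [hds', A.d_comp])
  exact ⟨f, hf, fun i => (h i).1.1, fun i => (h i).2⟩

end PermSeq

section Cons

/-- Put a type in front of a sequence of types. -/
def consType (Z : Type) (Δ : ℕ → Type) : ℕ → Type
  | 0 => Z
  | i + 1 => Δ i

variable {G : Type} [Group G]

/-- The actions on the members of a sequence of types with a new first member. -/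
@[reducible]
def consAct (Z : Type) (Δ : ℕ → Type) [MulAction G Z] [∀ i, MulAction G (Δ i)] :
    ∀ i, MulAction G (consType Z Δ i)
  | 0 => inferInstanceAs (MulAction G Z)
  | i + 1 => inferInstanceAs (MulAction G (Δ i))

/-- The differentials of a sequence of free abelian groups with a new first member. -/
noncomputable def consMap (Z : Type) (Δ : ℕ → Type) (e : (Δ 0 →₀ ℤ) →ₗ[ℤ] (Z →₀ ℤ))
    (d : ∀ i, (Δ (i + 1) →₀ ℤ) →ₗ[ℤ] (Δ i →₀ ℤ)) :
    ∀ i, (consType Z Δ (i + 1) →₀ ℤ) →ₗ[ℤ] (consType Z Δ i →₀ ℤ)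
  | 0 => e
  | i + 1 => d i

/-- Build an exact sequence of permutation modules from its augmentation and its tail. -/
noncomputable def PermSeq.cons (Z : Type) (Δ : ℕ → Type) [MulAction G Z]
    [∀ i, MulAction G (Δ i)] (e : (Δ 0 →₀ ℤ) →ₗ[ℤ] (Z →₀ ℤ))
    (d : ∀ i, (Δ (i + 1) →₀ ℤ) →ₗ[ℤ] (Δ i →₀ ℤ))
    (he : ∀ (g : G) z, e (permAct g z) = permAct g (e z))
    (hd : ∀ i (g : G) z, d i (permAct g z) = permAct g (d i z))
    (hed : ∀ z, e (d 0 z) = 0) (hdd : ∀ i z, d i (d (i + 1) z) = 0)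
    (hfin : ∀ i (x : Δ i), Finite (MulAction.stabilizer G x))
    (exact_aug : ∀ L : Subgroup G, Finite L → ∀ z, (∀ g ∈ L, permAct g z = z) →
      ∃ w, e w = z ∧ ∀ g ∈ L, permAct g w = w)
    (exact_zero : ∀ L : Subgroup G, Finite L → ∀ z, (∀ g ∈ L, permAct g z = z) → e z = 0 →
      ∃ w, d 0 w = z ∧ ∀ g ∈ L, permAct g w = w)
    (exact_succ : ∀ i, ∀ L : Subgroup G, Finite L → ∀ z, (∀ g ∈ L, permAct g z = z) →
      d i z = 0 → ∃ w, d (i + 1) w = z ∧ ∀ g ∈ L, permAct g w = w) :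
    PermSeq G where
  Δ := consType Z Δ
  act := consAct Z Δ
  d := consMap Z Δ e d
  map_permAct
    | 0 => he
    | i + 1 => hd i
  d_comp
    | 0 => hed
    | i + 1 => hdd i
  finite_stabilizer := hfin
  exact_zero := exact_aug
  exact_succ
    | 0 => exact_zero
    | i + 1 => exact_succ i

end Cons

section Comparison

variable {G : Type} [Group G]

/-- An `F`-resolution gives an exact sequence on fixed points of finite subgroups. -/
lemma FResolution.exists_permSeq {n : ℕ} (R : FResolution G n) :
    ∃ P : PermSeq G, P.LengthLE n ∧ Nonempty (Unique (P.Δ 0)) := by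
  let _ := R.act
  let e : (R.Δ 0 →₀ ℤ) →ₗ[ℤ] (Unit →₀ ℤ) :=
    (((Finsupp.singleAddHom ()).comp (trivialEquiv G).toAddMonoidHom).comp
      (R.ε.hom.toAddMonoidHom.comp (permModEquiv G (R.Δ 0)).symm.toAddMonoidHom)).toIntLinearMap
  have he : ∀ z, e z =
      Finsupp.single () (trivialEquiv G (R.ε ((permModEquiv G (R.Δ 0)).symm z))) := fun _ => rfl
  have hfix : ∀ (K : Subgroup G) {M : Type} [MulAction G M] {N : ModuleCat (MonoidAlgebra ℤ G)}
      (s : (resToSubgroup G K).obj N ⟶ (resToSubgroup G K).obj (permMod G M)) (x : N),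
      (∀ g ∈ K, MonoidAlgebra.single g (1 : ℤ) • x = x) → ∀ g ∈ K,
      permAct g (permModEquiv G M (resEquiv K _ (s ((resEquiv K _).symm x)))) =
        permModEquiv G M (resEquiv K _ (s ((resEquiv K _).symm x))) := by
    intro K M _ N s x hx g hg
    rw [← permModEquiv_smul, ← resEquiv_hom_smul K s g hg, hx g hg]
  have hfix' : ∀ (K : Subgroup G) {M : Type} [MulAction G M] (z : M →₀ ℤ),
      (∀ g ∈ K, permAct g z = z) → ∀ g ∈ K, MonoidAlgebra.single g (1 : ℤ) •
        (permModEquiv G M).symm z = (permModEquiv G M).symm z := by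
    intro K M _ z hz g hg
    rw [← permModEquiv_symm_smul, hz g hg]
  have hd0 : ∀ i z, permHomToLinear (R.d i) z = 0 → R.d i ((permModEquiv G _).symm z) = 0 :=
    fun i z hz => (permModEquiv G _).map_eq_zero_iff.1 hz
  refine ⟨PermSeq.cons Unit R.Δ e (fun i => permHomToLinear (R.d i)) (fun g z => ?_)
    (fun i => permHomToLinear_permAct _) (fun z => ?_) (fun i z => ?_) R.finite_stabilizers
    (fun L hL z hz => ?_) (fun L hL z hz hdz => ?_) (fun i L hL z hz hdz => ?_),
    R.empty_above, ⟨(inferInstance : Unique Unit)⟩⟩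
  · rw [he, he, permModEquiv_symm_smul, map_smul, trivialEquiv_smul, permAct_single]
  · rw [he, permHomToLinear_apply, AddEquiv.symm_apply_apply, R.exact_zero.apply_apply_eq_zero]
    simp
  · rw [permHomToLinear_apply, permHomToLinear_apply, AddEquiv.symm_apply_apply,
      (R.exact_succ i).apply_apply_eq_zero, map_zero]
  · obtain ⟨s, σ, h₀, h₁, h₂⟩ := R.split L hL
    refine ⟨permModEquiv G _ (resEquiv L _ (σ ((resEquiv L _).symm
      ((trivialEquiv G).symm (z ()))))), ?_, hfix L σ _ fun g _ => trivial_smul g _⟩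
    rw [he, AddEquiv.symm_apply_apply, ← resEquiv_map]
    have := congrArg (fun f => resEquiv L _ (f ((resEquiv L _).symm
      ((trivialEquiv G).symm (z ()))))) h₀
    simp only [ModuleCat.comp_apply, ModuleCat.id_apply, AddEquiv.apply_symm_apply] at this
    rw [this, AddEquiv.apply_symm_apply]
    exact (Finsupp.unique_single z).symm
  · obtain ⟨s, σ, h₀, h₁, h₂⟩ := R.split L hL
    refine ⟨_, ?_, hfix L (s 0) _ (hfix' L z hz)⟩
    rw [permHomToLinear_apply, AddEquiv.symm_apply_apply, ← resEquiv_map]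
    have hz' : R.ε ((permModEquiv G (R.Δ 0)).symm z) = 0 := by
      rw [he, Finsupp.single_eq_zero] at hdz
      exact (trivialEquiv G).map_eq_zero_iff.1 hdz
    have hz'' : (resToSubgroup G L).map R.ε ((resEquiv L _).symm
        ((permModEquiv G _).symm z)) = 0 := hz'
    have := congrArg (fun f => permModEquiv G _ (resEquiv L _ (f ((resEquiv L _).symm
      ((permModEquiv G _).symm z))))) h₁
    simpa [hz''] using this
  · obtain ⟨s, σ, h₀, h₁, h₂⟩ := R.split L hL
    refine ⟨_, ?_, hfix L (s (i + 1)) _ (hfix' L z hz)⟩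
    rw [permHomToLinear_apply, AddEquiv.symm_apply_apply, ← resEquiv_map]
    have hz'' : (resToSubgroup G L).map (R.d i) ((resEquiv L _).symm
        ((permModEquiv G _).symm z)) = 0 := hd0 i z hdz
    have := congrArg (fun f => permModEquiv G _ (resEquiv L _ (f ((resEquiv L _).symm
      ((permModEquiv G _).symm z))))) (h₂ i)
    simpa [hz''] using this

lemma permHomOfLinear_exact {X Y Z : Type} [MulAction G X] [MulAction G Y] [MulAction G Z]
    (f : (X →₀ ℤ) →ₗ[ℤ] (Y →₀ ℤ)) (f' : (Y →₀ ℤ) →ₗ[ℤ] (Z →₀ ℤ))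
    (hf : ∀ (g : G) z, f (permAct g z) = permAct g (f z))
    (hf' : ∀ (g : G) z, f' (permAct g z) = permAct g (f' z))
    (hff' : ∀ z, f' (f z) = 0) (h : ∀ z, f' z = 0 → ∃ w, f w = z) :
    Function.Exact (permHomOfLinear f hf) (permHomOfLinear f' hf') := by
  intro y
  rw [permHomOfLinear_apply, AddEquiv.map_eq_zero_iff]
  constructor
  · intro hy
    obtain ⟨w, hw⟩ := h _ hy
    refine ⟨(permModEquiv G X).symm w, ?_⟩
    rw [permHomOfLinear_apply, AddEquiv.apply_symm_apply, hw, AddEquiv.symm_apply_apply]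
  · rintro ⟨x, rfl⟩
    rw [permHomOfLinear_apply, AddEquiv.apply_symm_apply, hff']

/-- An exact sequence on fixed points whose last term has a single basis element gives an
`F`-resolution. -/
lemma PermSeq.fcdLE (P : PermSeq G) {n : ℕ} (hP : P.LengthLE n) [Unique (P.Δ 0)] :
    FcdLE G n := by
  let η : (P.Δ 0 →₀ ℤ) ≃+ trivialZModule G :=
    (Finsupp.uniqueLinearEquiv ℤ ℤ (default : P.Δ 0)).toAddEquiv.trans (trivialEquiv G).symm
  have hη : ∀ (g : G) (z : P.Δ 0 →₀ ℤ), permAct g z = z := fun g z => by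
    induction z using Finsupp.induction_linear with
    | zero => simp
    | add a b ha hb => rw [map_add, ha, hb]
    | single x c => rw [permAct_single, Subsingleton.elim (g • x) x]
  let ε : permMod G (P.Δ 1) ⟶ trivialZModule G :=
    ModuleCat.ofHom (X := permMod G (P.Δ 1)) (Y := trivialZModule G) (linearOfCommutes
      ((η.toAddMonoidHom.comp (P.d 0).toAddMonoidHom).comp (permModEquiv G (P.Δ 1)).toAddMonoidHom)
      fun g x => (congrArg (fun y => η (P.d 0 y)) (permModEquiv_smul g x)).trans
        ((congrArg η ((P.map_permAct 0 g _).trans (hη g _))).trans (trivial_smul g _).symm))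
  have hε : ∀ x, ε x = η (P.d 0 (permModEquiv G (P.Δ 1) x)) := fun _ => rfl
  have hbot : ∀ {M : Type} [MulAction G M] (z : M →₀ ℤ), ∀ g ∈ (⊥ : Subgroup G),
      permAct g z = z := by
    intro M _ z g hg
    rw [Subgroup.mem_bot.1 hg, permAct_one]
  have ex0 : ∀ z, ∃ w, P.d 0 w = z := fun z => by
    obtain ⟨w, hw, _⟩ := P.exact_zero ⊥ inferInstance z (hbot z)
    exact ⟨w, hw⟩
  have ex1 : ∀ i z, P.d i z = 0 → ∃ w, P.d (i + 1) w = z := fun i z hz => by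
    obtain ⟨w, hw, _⟩ := P.exact_succ i ⊥ inferInstance z (hbot z) hz
    exact ⟨w, hw⟩
  refine ⟨{ Δ := fun i => P.Δ (i + 1), act := fun i => P.act (i + 1),
            finite_stabilizers := P.finite_stabilizer, empty_above := hP,
            d := fun i => permHomOfLinear (P.d (i + 1)) (P.map_permAct (i + 1)), ε := ε,
            eps_surjective := ?_, exact_zero := ?_, exact_succ := ?_, split := ?_ }⟩
  · intro y
    obtain ⟨w, hw⟩ := ex0 (η.symm y)
    refine ⟨(permModEquiv G (P.Δ 1)).symm w, ?_⟩
    rw [hε, AddEquiv.apply_symm_apply, hw, AddEquiv.apply_symm_apply]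
  · intro x
    rw [hε, AddEquiv.map_eq_zero_iff]
    constructor
    · intro hx
      obtain ⟨w, hw⟩ := ex1 0 _ hx
      refine ⟨(permModEquiv G _).symm w, ?_⟩
      rw [permHomOfLinear_apply, AddEquiv.apply_symm_apply, hw, AddEquiv.symm_apply_apply]
    · rintro ⟨w, rfl⟩
      rw [permHomOfLinear_apply, AddEquiv.apply_symm_apply, P.d_comp]
  · exact fun i => permHomOfLinear_exact _ _ _ _ (P.d_comp (i + 1)) (ex1 (i + 1))
  · intro K hK
    obtain ⟨t, ht, ht0, htd⟩ := P.exists_contraction K hK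
    refine ⟨fun i => resHomOfCommutes K
      (((permModEquiv G _).symm.toAddMonoidHom.comp (t (i + 1)).toAddMonoidHom).comp
        (permModEquiv G _).toAddMonoidHom) (fun k hk x => ?_),
      resHomOfCommutes K
        (((permModEquiv G _).symm.toAddMonoidHom.comp (t 0).toAddMonoidHom).comp
          η.symm.toAddMonoidHom) (fun k hk x => ?_), ?_, ?_, fun i => ?_⟩
    · change (permModEquiv G _).symm (t (i + 1) (permModEquiv G _ _)) =
        _ • (permModEquiv G _).symm (t (i + 1) (permModEquiv G _ _))
      rw [permModEquiv_smul, ht (i + 1) k hk, permModEquiv_symm_smul]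
    · change (permModEquiv G _).symm (t 0 (η.symm _)) =
        _ • (permModEquiv G _).symm (t 0 (η.symm _))
      rw [trivial_smul, ← permModEquiv_symm_smul, ← ht 0 k hk, hη]
    · ext x
      change η (P.d 0 (permModEquiv G _ ((permModEquiv G _).symm (t 0 (η.symm x))))) = x
      rw [AddEquiv.apply_symm_apply, ht0]
      exact η.apply_symm_apply x
    · ext x
      change (permModEquiv G _).symm (t 0 (η.symm (η (P.d 0 (permModEquiv G _ x))))) +
        (permModEquiv G _).symm (P.d 1 (permModEquiv G _
          ((permModEquiv G _).symm (t 1 (permModEquiv G _ x))))) = x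
      rw [AddEquiv.symm_apply_apply, AddEquiv.apply_symm_apply, ← map_add, htd]
      exact (permModEquiv G _).symm_apply_apply _
    · ext x
      change (permModEquiv G _).symm (t (i + 1) (permModEquiv G _ ((permModEquiv G _).symm
          (P.d (i + 1) (permModEquiv G _ x))))) +
        (permModEquiv G _).symm (P.d (i + 2) (permModEquiv G _
          ((permModEquiv G _).symm (t (i + 2) (permModEquiv G _ x))))) = x
      rw [AddEquiv.apply_symm_apply, AddEquiv.apply_symm_apply, ← map_add, htd]
      exact (permModEquiv G _).symm_apply_apply _

end Comparison

section Cone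

variable {G : Type} [Group G]

lemma sumFinsuppLEquivProdFinsupp_permAct {X Y : Type} [MulAction G X] [MulAction G Y] (g : G)
    (z : (X ⊕ Y) →₀ ℤ) :
    Finsupp.sumFinsuppLEquivProdFinsupp ℤ (permAct g z) =
      (permAct g (Finsupp.sumFinsuppLEquivProdFinsupp ℤ z).1,
        permAct g (Finsupp.sumFinsuppLEquivProdFinsupp ℤ z).2) := by
  induction z using Finsupp.induction_linear with
  | zero => simp
  | add a b ha hb =>
    rw [map_add, map_add, ha, hb, map_add, Prod.fst_add, Prod.snd_add, map_add, map_add]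
    rfl
  | single x c =>
    have hl : ∀ x : X, Finsupp.sumFinsuppLEquivProdFinsupp ℤ
        (Finsupp.single (Sum.inl x : X ⊕ Y) c) = (Finsupp.single x c, 0) := fun x => by
      ext y <;> simp
    have hr : ∀ y : Y, Finsupp.sumFinsuppLEquivProdFinsupp ℤ
        (Finsupp.single (Sum.inr y : X ⊕ Y) c) = (0, Finsupp.single y c) := fun y => by
      ext x <;> simp
    rcases x with x | y
    · rw [permAct_single, Sum.smul_inl, hl, hl]
      simp
    · rw [permAct_single, Sum.smul_inr, hr, hr]
      simp

/-- Splicing resolutions of `ℤ[A.Δ 0]` and `ℤ[B.Δ 0]` along a short sequence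
`0 → ℤ[A.Δ 0] → ℤ[B.Δ 0] → ℤ[Z] → 0` that is exact on fixed points of finite subgroups. -/
lemma PermSeq.exists_cone (A B : PermSeq G) (Z : Type) [MulAction G Z]
    (φ : (A.Δ 0 →₀ ℤ) →ₗ[ℤ] (B.Δ 0 →₀ ℤ)) (η : (B.Δ 0 →₀ ℤ) →ₗ[ℤ] (Z →₀ ℤ))
    (hφ : ∀ (g : G) z, φ (permAct g z) = permAct g (φ z))
    (hη : ∀ (g : G) z, η (permAct g z) = permAct g (η z))
    (φ_inj : Function.Injective φ) (hηφ : ∀ z, η (φ z) = 0)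
    (exact_left : ∀ L : Subgroup G, Finite L → ∀ z, (∀ g ∈ L, permAct g z = z) → η z = 0 →
      ∃ w, φ w = z ∧ ∀ g ∈ L, permAct g w = w)
    (exact_right : ∀ L : Subgroup G, Finite L → ∀ z, (∀ g ∈ L, permAct g z = z) →
      ∃ w, η w = z ∧ ∀ g ∈ L, permAct g w = w)
    {n : ℕ} (hA : A.LengthLE n) (hB : B.LengthLE n) :
    ∃ P : PermSeq G, P.LengthLE (n + 1) ∧ P.Δ 0 = Z := by
  obtain ⟨f, rfl, hf, hdf⟩ := A.exists_chainMap B φ hφ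
  let W : ℕ → Type := fun i => B.Δ (i + 2) ⊕ A.Δ (i + 1)
  let S : ∀ i, (W i →₀ ℤ) ≃ₗ[ℤ] (B.Δ (i + 2) →₀ ℤ) × (A.Δ (i + 1) →₀ ℤ) := fun i =>
    Finsupp.sumFinsuppLEquivProdFinsupp ℤ
  have hS : ∀ i (g : G) (z : W i →₀ ℤ),
      S i (permAct g z) = (permAct g (S i z).1, permAct g (S i z).2) := fun i =>
    sumFinsuppLEquivProdFinsupp_permAct
  obtain ⟨e, he⟩ : ∃ e : (W 0 →₀ ℤ) →ₗ[ℤ] (B.Δ 1 →₀ ℤ),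
      ∀ z, e z = B.d 1 (S 0 z).1 + f 1 (S 0 z).2 :=
    ⟨(B.d 1 ∘ₗ LinearMap.fst ℤ _ _ + f 1 ∘ₗ LinearMap.snd ℤ _ _) ∘ₗ (S 0).toLinearMap,
      fun _ => rfl⟩
  obtain ⟨d, hd⟩ : ∃ d : ∀ i, (W (i + 1) →₀ ℤ) →ₗ[ℤ] (W i →₀ ℤ), ∀ i z, S i (d i z) =
      (B.d (i + 2) (S (i + 1) z).1 + f (i + 2) (S (i + 1) z).2, -A.d (i + 1) (S (i + 1) z).2) :=
    ⟨fun i => (S i).symm.toLinearMap ∘ₗ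
      ((B.d (i + 2) ∘ₗ LinearMap.fst ℤ _ _ + f (i + 2) ∘ₗ LinearMap.snd ℤ _ _).prod
        (-(A.d (i + 1) ∘ₗ LinearMap.snd ℤ _ _))) ∘ₗ (S (i + 1)).toLinearMap,
      fun i z => (S i).apply_symm_apply _⟩
  have hfix : ∀ i (L : Subgroup G) (z : W i →₀ ℤ), (∀ g ∈ L, permAct g z = z) →
      (∀ g ∈ L, permAct g (S i z).1 = (S i z).1) ∧ ∀ g ∈ L, permAct g (S i z).2 = (S i z).2 := by
    intro i L z hz
    refine ⟨fun g hg => ?_, fun g hg => ?_⟩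
    · conv_rhs => rw [← hz g hg, hS]
    · conv_rhs => rw [← hz g hg, hS]
  have key : ∀ i (L : Subgroup G), Finite L → ∀ z : W i →₀ ℤ, (∀ g ∈ L, permAct g z = z) →
      A.d i (S i z).2 = 0 → B.d (i + 1) (S i z).1 + f (i + 1) (S i z).2 = 0 →
      ∃ w, d i w = z ∧ ∀ g ∈ L, permAct g w = w := by
    intro i L hL z hz hA hB
    obtain ⟨a, ha, hafix⟩ := A.exact_succ i L hL _ (hfix i L z hz).2 hA
    obtain ⟨b, hb, hbfix⟩ := B.exact_succ (i + 1) L hL ((S i z).1 + f (i + 2) a)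
      (fun g hg => by rw [map_add, ← hf, hafix g hg, (hfix i L z hz).1 g hg])
      (by rw [map_add, hdf, ha, hB])
    refine ⟨(S (i + 1)).symm (b, -a), (S i).injective ?_, fun g hg => (S (i + 1)).injective ?_⟩
    · rw [hd, LinearEquiv.apply_symm_apply]
      ext1 <;> simp [hb, ha]
    · rw [hS, LinearEquiv.apply_symm_apply]
      simp [hafix g hg, hbfix g hg]
  have hdd : ∀ i z, d i (d (i + 1) z) = 0 := fun i z => (S i).injective <| by
    rw [hd, hd, map_zero]
    ext1 <;> simp [hdf, B.d_comp, A.d_comp]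
  have hd_act : ∀ i (g : G) z, d i (permAct g z) = permAct g (d i z) := fun i g z =>
    (S i).injective <| by
      rw [hd, hS, hS, hd]
      simp [B.map_permAct, A.map_permAct, hf]
  have he_act : ∀ (g : G) z, e (permAct g z) = permAct g (e z) := fun g z => by
    rw [he, he, hS]
    simp [B.map_permAct, hf]
  have hed : ∀ z, e (d 0 z) = 0 := fun z => by
    rw [he, hd]
    simp [hdf, B.d_comp]
  have hfinW : ∀ i (x : W i), Finite (MulAction.stabilizer G x) := by
    rintro i (x | x)
    · refine @Finite.of_injective _ _ (B.finite_stabilizer (i + 1) x)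
        (fun g => ⟨g, Sum.inl_injective g.2⟩) fun g h hgh => ?_
      have := congrArg Subtype.val hgh
      exact Subtype.ext this
    · refine @Finite.of_injective _ _ (A.finite_stabilizer i x)
        (fun g => ⟨g, Sum.inr_injective g.2⟩) fun g h hgh => ?_
      have := congrArg Subtype.val hgh
      exact Subtype.ext this
  have ex_e : ∀ L : Subgroup G, Finite L → ∀ z, (∀ g ∈ L, permAct g z = z) → e z = 0 →
      ∃ w, d 0 w = z ∧ ∀ g ∈ L, permAct g w = w := by
    intro L hL z hz hez
    rw [he] at hez
    refine key 0 L hL z hz (φ_inj ?_) hez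
    have := congrArg (B.d 0) hez
    rw [map_add, B.d_comp, hdf, zero_add, map_zero] at this
    rw [this, map_zero]
  have ex_d : ∀ i (L : Subgroup G), Finite L → ∀ z, (∀ g ∈ L, permAct g z = z) → d i z = 0 →
      ∃ w, d (i + 1) w = z ∧ ∀ g ∈ L, permAct g w = w := by
    intro i L hL z hz hdz
    have h := hd i z
    rw [hdz, map_zero, eq_comm, Prod.mk_eq_zero, neg_eq_zero] at h
    exact key (i + 1) L hL z hz h.2 h.1
  have ex_B : ∀ L : Subgroup G, Finite L → ∀ z, (∀ g ∈ L, permAct g z = z) → η (B.d 0 z) = 0 →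
      ∃ w, e w = z ∧ ∀ g ∈ L, permAct g w = w := by
    intro L hL z hz hηz
    obtain ⟨x, hx, hxfix⟩ := exact_left L hL (B.d 0 z)
      (fun g hg => by rw [← B.map_permAct, hz g hg]) hηz
    obtain ⟨a, ha, hafix⟩ := A.exact_zero L hL x hxfix
    obtain ⟨b, hb, hbfix⟩ := B.exact_succ 0 L hL (z - f 1 a)
      (fun g hg => by rw [map_sub, ← hf, hafix g hg, hz g hg])
      (by rw [map_sub, hdf, ha, hx, sub_self])
    refine ⟨(S 0).symm (b, a), ?_, fun g hg => (S 0).injective ?_⟩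
    · rw [he, LinearEquiv.apply_symm_apply]
      simp [hb]
    · rw [hS, LinearEquiv.apply_symm_apply]
      simp [hafix g hg, hbfix g hg]
  have ex_Z : ∀ L : Subgroup G, Finite L → ∀ z, (∀ g ∈ L, permAct g z = z) →
      ∃ w, (η ∘ₗ B.d 0) w = z ∧ ∀ g ∈ L, permAct g w = w := by
    intro L hL z hz
    obtain ⟨y, hy, hyfix⟩ := exact_right L hL z hz
    obtain ⟨x, hx, hxfix⟩ := B.exact_zero L hL y hyfix
    exact ⟨x, by simp [hx, hy], hxfix⟩
  have hηe : ∀ z, η (B.d 0 (e z)) = 0 := fun z => by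
    rw [he, map_add, B.d_comp, hdf, zero_add, hηφ]
  let _ := consAct (G := G) (B.Δ 1) W
  refine ⟨PermSeq.cons Z (consType (B.Δ 1) W) (η ∘ₗ B.d 0) (consMap (B.Δ 1) W e d)
    (fun g z => (congrArg η (B.map_permAct 0 g z)).trans (hη g _))
    (fun | 0 => he_act | i + 1 => hd_act i)
    hηe (fun | 0 => hed | i + 1 => hdd i)
    (fun | 0 => B.finite_stabilizer 0 | i + 1 => hfinW i) ex_Z ex_B
    (fun | 0 => ex_e | i + 1 => ex_d i), ?_, rfl⟩
  rintro (_ | i) hi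
  · omega
  · have h1 := hB (i + 1) (by omega)
    have h2 := hA i (by omega)
    exact inferInstanceAs (IsEmpty (B.Δ (i + 2) ⊕ A.Δ (i + 1)))

end Cone

section Induction

/-- A family of cocycles on `G`-sets `Y a` with values in groups `S a`, injective on point
stabilizers. -/
structure OrbitCocycle (G : Type) [Group G] {Ω : Type} (Y S : Ω → Type)
    [∀ a, MulAction G (Y a)] [∀ a, Group (S a)] where
  val : ∀ a, G → Y a → S a
  val_mul : ∀ a g h y, val a (g * h) y = val a g (h • y) * val a h y
  val_inj : ∀ a g h y, g • y = y → h • y = y → val a g y = val a h y → g = h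

variable {G : Type} [Group G] {Ω : Type} {Y S : Ω → Type}
  [∀ a, MulAction G (Y a)] [∀ a, Group (S a)]

/-- The union of the products `Y a × F a`. -/
structure Twisted (c : OrbitCocycle G Y S) (F : Ω → Type) where
  idx : Ω
  base : Y idx
  fib : F idx

namespace Twisted

variable {c : OrbitCocycle G Y S} {F F' : Ω → Type}

lemma mk_injective (a : Ω) (y : Y a) :
    Function.Injective fun x : F a => (⟨a, y, x⟩ : Twisted c F) := fun x x' h => by
  simpa using h

/-- Inclusion of the fibre over `y`. -/
noncomputable def incl (c : OrbitCocycle G Y S) (F : Ω → Type) (a : Ω) (y : Y a) :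
    (F a →₀ ℤ) →ₗ[ℤ] (Twisted c F →₀ ℤ) :=
  Finsupp.lmapDomain ℤ ℤ fun x => ⟨a, y, x⟩

/-- Projection to the fibre over `y`. -/
noncomputable def proj (c : OrbitCocycle G Y S) (F : Ω → Type) (a : Ω) (y : Y a) :
    (Twisted c F →₀ ℤ) →ₗ[ℤ] (F a →₀ ℤ) :=
  Finsupp.lcomapDomain (fun x => ⟨a, y, x⟩) (mk_injective a y)

@[simp] lemma incl_single (a : Ω) (y : Y a) (x : F a) (n : ℤ) :
    incl c F a y (Finsupp.single x n) = Finsupp.single ⟨a, y, x⟩ n := by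
  simp [incl]

lemma proj_apply (a : Ω) (y : Y a) (z : Twisted c F →₀ ℤ) (x : F a) :
    proj c F a y z x = z ⟨a, y, x⟩ := rfl

@[simp] lemma proj_incl (a : Ω) (y : Y a) (z : F a →₀ ℤ) :
    proj c F a y (incl c F a y z) = z := by
  ext x
  exact Finsupp.mapDomain_apply (mk_injective a y) z x

lemma proj_incl_of_ne {a a' : Ω} {y : Y a} {y' : Y a'}
    (h : (⟨a, y⟩ : Σ a, Y a) ≠ ⟨a', y'⟩) (z : F a' →₀ ℤ) :
    proj c F a y (incl c F a' y' z) = 0 := by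
  ext x
  refine Finsupp.mapDomain_of_notMem_range _ _ ?_
  rintro ⟨x', hx'⟩
  simp only [mk.injEq] at hx'
  obtain ⟨rfl, hy, -⟩ := hx'
  exact h (by rw [eq_of_heq hy])

lemma hom_ext {M : Type} [AddCommGroup M] {f g : (Twisted c F →₀ ℤ) →ₗ[ℤ] M}
    (h : ∀ (a : Ω) (y : Y a) (x : F a), f (incl c F a y (Finsupp.single x 1)) =
      g (incl c F a y (Finsupp.single x 1))) : f = g := by
  ext ⟨a, y, x⟩
  simpa using h a y x

lemma support_incl_proj_finite (z : Twisted c F →₀ ℤ) :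
    {b : Σ a, Y a | proj c F b.1 b.2 z ≠ 0}.Finite := by
  refine (z.support.finite_toSet.image fun t => (⟨t.idx, t.base⟩ : Σ a, Y a)).subset fun b hb => ?_
  obtain ⟨x, hx⟩ := Finsupp.ne_iff.1 hb
  exact ⟨⟨b.1, b.2, x⟩, by simpa [proj_apply] using hx, rfl⟩

lemma finsum_incl_proj (z : Twisted c F →₀ ℤ) :
    ∑ᶠ b : Σ a, Y a, incl c F b.1 b.2 (proj c F b.1 b.2 z) = z := by
  have hs : Function.support (fun b : Σ a, Y a => incl c F b.1 b.2 (proj c F b.1 b.2 z)) ⊆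
      {b | proj c F b.1 b.2 z ≠ 0} := fun b hb h => hb (by simp [h])
  ext ⟨a, y, x⟩
  have := (Finsupp.applyAddHom (⟨a, y, x⟩ : Twisted c F)).map_finsum
    ((support_incl_proj_finite z).subset hs)
  refine this.trans ((finsum_eq_single _ ⟨a, y⟩ fun b hb => ?_).trans ?_)
  · exact DFunLike.congr_fun (proj_incl_of_ne (c := c) hb.symm (proj c F b.1 b.2 z)) x
  · exact DFunLike.congr_fun (proj_incl (c := c) a y (proj c F a y z)) x

/-- The map of twisted permutation modules induced by maps of fibres. -/
noncomputable def map (c : OrbitCocycle G Y S) (d : ∀ a, (F a →₀ ℤ) →ₗ[ℤ] (F' a →₀ ℤ)) :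
    (Twisted c F →₀ ℤ) →ₗ[ℤ] (Twisted c F' →₀ ℤ) :=
  Finsupp.linearCombination ℤ fun t => incl c F' t.idx t.base (d t.idx (Finsupp.single t.fib 1))

lemma map_incl (d : ∀ a, (F a →₀ ℤ) →ₗ[ℤ] (F' a →₀ ℤ)) (a : Ω) (y : Y a) (z : F a →₀ ℤ) :
    map c d (incl c F a y z) = incl c F' a y (d a z) := by
  have : map c d ∘ₗ incl c F a y = incl c F' a y ∘ₗ d a := by
    ext1 x
    ext1
    simp [map]
  exact LinearMap.congr_fun this z

lemma proj_map (d : ∀ a, (F a →₀ ℤ) →ₗ[ℤ] (F' a →₀ ℤ)) (a : Ω) (y : Y a)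
    (z : Twisted c F →₀ ℤ) : proj c F' a y (map c d z) = d a (proj c F a y z) := by
  have : proj c F' a y ∘ₗ map c d = d a ∘ₗ proj c F a y := by
    refine hom_ext fun a' y' x => ?_
    rw [LinearMap.comp_apply, LinearMap.comp_apply, map_incl]
    by_cases h : (⟨a, y⟩ : Σ a, Y a) = ⟨a', y'⟩
    · cases h
      rw [proj_incl, proj_incl]
    · rw [proj_incl_of_ne h, proj_incl_of_ne h, map_zero]
  exact LinearMap.congr_fun this z

lemma val_one (c : OrbitCocycle G Y S) (a : Ω) (y : Y a) : c.val a 1 y = 1 := by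
  have := c.val_mul a 1 1 y
  rwa [mul_one, one_smul, left_eq_mul] at this

variable [∀ a, MulAction (S a) (F a)] [∀ a, MulAction (S a) (F' a)]

/-- The group acts on fibres through the cocycle. -/
instance : MulAction G (Twisted c F) where
  smul g t := ⟨t.idx, g • t.base, c.val t.idx g t.base • t.fib⟩
  one_smul t := by
    change (⟨t.idx, (1 : G) • t.base, c.val t.idx 1 t.base • t.fib⟩ : Twisted c F) = t
    rw [val_one, one_smul, one_smul]
  mul_smul g h t := by
    change (⟨t.idx, (g * h) • t.base, c.val t.idx (g * h) t.base • t.fib⟩ : Twisted c F) =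
      ⟨t.idx, g • h • t.base, c.val t.idx g (h • t.base) • c.val t.idx h t.base • t.fib⟩
    rw [c.val_mul, mul_smul, mul_smul]

lemma smul_mk (g : G) (a : Ω) (y : Y a) (x : F a) :
    g • (⟨a, y, x⟩ : Twisted c F) = ⟨a, g • y, c.val a g y • x⟩ := rfl

lemma permAct_incl (g : G) (a : Ω) (y : Y a) (z : F a →₀ ℤ) :
    permAct g (incl c F a y z) = incl c F a (g • y) (permAct (c.val a g y) z) := by
  have : permAct g ∘ₗ incl c F a y = incl c F a (g • y) ∘ₗ permAct (c.val a g y) := by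
    ext1 x
    ext1
    simp [smul_mk]
  exact LinearMap.congr_fun this z

lemma proj_permAct (g : G) (a : Ω) (y : Y a) (z : Twisted c F →₀ ℤ) :
    proj c F a (g • y) (permAct g z) = permAct (c.val a g y) (proj c F a y z) := by
  have : proj c F a (g • y) ∘ₗ permAct g = permAct (c.val a g y) ∘ₗ proj c F a y := by
    refine hom_ext fun a' y' x => ?_
    rw [LinearMap.comp_apply, LinearMap.comp_apply, permAct_incl]
    by_cases h : (⟨a, y⟩ : Σ a, Y a) = ⟨a', y'⟩
    · cases h
      rw [proj_incl, proj_incl]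
    · rw [proj_incl_of_ne h, map_zero, proj_incl_of_ne]
      intro h'
      exact h (MulAction.injective g h')
  exact LinearMap.congr_fun this z

variable (d : ∀ a, (F a →₀ ℤ) →ₗ[ℤ] (F' a →₀ ℤ))

lemma map_permAct (hd : ∀ a (s : S a) z, d a (permAct s z) = permAct s (d a z)) (g : G)
    (z : Twisted c F →₀ ℤ) : map c d (permAct g z) = permAct g (map c d z) := by
  have : map c d ∘ₗ permAct g = permAct g ∘ₗ map c d := by
    refine hom_ext fun a y x => ?_
    rw [LinearMap.comp_apply, LinearMap.comp_apply, permAct_incl, map_incl, map_incl,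
      permAct_incl, hd]
  exact LinearMap.congr_fun this z

/-- Solvability of `d w = z` on fixed points passes from the fibres to the twisted union. -/
lemma exists_map_eq (hd : ∀ a (s : S a) z, d a (permAct s z) = permAct s (d a z))
    (L : Subgroup G) (hL : Finite L) (z : Twisted c F' →₀ ℤ) (hz : ∀ g ∈ L, permAct g z = z)
    (hex : ∀ (a : Ω) (y : Y a) (K : Subgroup (S a)), Finite K →
      (∀ s ∈ K, permAct s (proj c F' a y z) = proj c F' a y z) →
      ∃ w, d a w = proj c F' a y z ∧ ∀ s ∈ K, permAct s w = w) :
    ∃ w, map c d w = z ∧ ∀ g ∈ L, permAct g w = w := by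
  have hproj : ∀ g ∈ L, ∀ (a : Ω) (y : Y a),
      proj c F' a (g • y) z = permAct (c.val a g y) (proj c F' a y z) := fun g hg a y => by
    rw [← proj_permAct, hz g hg]
  obtain ⟨f, hf, hQ⟩ := exists_permAct_equivariant_choice (X := Σ a, Y a) (Y := Twisted c F) L
    (fun b w => map c d w = incl c F' b.1 b.2 (proj c F' b.1 b.2 z) ∧
      (proj c F' b.1 b.2 z = 0 → w = 0))
    (by
      rintro g hg ⟨a, y⟩ w ⟨h1, h2⟩
      change map c d (permAct g w) = incl c F' a (g • y) (proj c F' a (g • y) z) ∧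
        (proj c F' a (g • y) z = 0 → permAct g w = 0)
      rw [hproj g hg]
      refine ⟨by rw [map_permAct d hd, h1, permAct_incl], fun h => ?_⟩
      have h3 := congrArg (permAct (c.val a g y)⁻¹) h
      rw [map_zero, ← permAct_mul, inv_mul_cancel, permAct_one] at h3
      rw [h2 h3, map_zero])
    (by
      rintro ⟨a, y⟩
      by_cases h0 : proj c F' a y z = 0
      · exact ⟨0, ⟨by simp [h0], fun _ => rfl⟩, fun _ _ _ => map_zero _⟩
      let K : Subgroup (S a) :=
        { carrier := {s | ∃ g ∈ L, g • y = y ∧ c.val a g y = s}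
          mul_mem' := by
            rintro _ _ ⟨g, hg, hgy, rfl⟩ ⟨h, hh, hhy, rfl⟩
            exact ⟨g * h, L.mul_mem hg hh, by rw [mul_smul, hhy, hgy], by rw [c.val_mul, hhy]⟩
          one_mem' := ⟨1, L.one_mem, one_smul _ _, val_one c a y⟩
          inv_mem' := by
            rintro _ ⟨g, hg, hgy, rfl⟩
            refine ⟨g⁻¹, L.inv_mem hg, by rw [inv_smul_eq_iff, hgy], ?_⟩
            rw [eq_inv_iff_mul_eq_one, ← val_one c a y, ← inv_mul_cancel g, c.val_mul, hgy] }
      have hK : Finite K := by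
        refine Set.Finite.subset (Set.finite_range fun g : L => c.val a g.1 y) ?_
        rintro _ ⟨g, hg, -, rfl⟩
        exact ⟨⟨g, hg⟩, rfl⟩
      obtain ⟨w, hw, hwfix⟩ := hex a y K hK (by
        rintro _ ⟨g, hg, hgy, rfl⟩
        rw [← hproj g hg, hgy])
      refine ⟨incl c F a y w, ⟨by rw [map_incl, hw], fun h => absurd h h0⟩, fun g hg hgb => ?_⟩
      have hgy : g • y = y := eq_of_heq (Sigma.mk.inj hgb).2
      rw [permAct_incl, hwfix _ ⟨g, hg, hgy, rfl⟩, hgy])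
  have hfin : (Function.support f).Finite :=
    (support_incl_proj_finite z).subset fun b hb h => hb ((hQ b).2 h)
  refine ⟨∑ᶠ b, f b, ?_, fun g hg => ?_⟩
  · have := (map c d).toAddMonoidHom.map_finsum hfin
    exact this.trans ((finsum_congr fun b => (hQ b).1).trans (finsum_incl_proj z))
  · have := (permAct (Δ := Twisted c F) g).toAddMonoidHom.map_finsum hfin
    refine this.trans ((finsum_congr fun b => (hf g hg b).symm).trans ?_)
    exact finsum_comp_equiv (MulAction.toPerm g)

lemma finite_stabilizer (t : Twisted c F) (ht : Finite (MulAction.stabilizer (S t.idx) t.fib)) :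
    Finite (MulAction.stabilizer G t) := by
  have h : ∀ g ∈ MulAction.stabilizer G t, g • t.base = t.base ∧
      c.val t.idx g t.base • t.fib = t.fib := fun g hg => by
    obtain ⟨a, y, x⟩ := t
    have h1 : g • (⟨a, y, x⟩ : Twisted c F) = ⟨a, y, x⟩ := hg
    simpa [smul_mk] using h1
  refine Finite.of_injective (β := MulAction.stabilizer (S t.idx) t.fib)
    (fun g => ⟨c.val t.idx g.1 t.base, (h g.1 g.2).2⟩) fun g g' hgg' => ?_
  have := congrArg Subtype.val hgg'
  exact Subtype.ext (c.val_inj _ _ _ _ (h g.1 g.2).1 (h g'.1 g'.2).1 this)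

end Twisted

/-- The twisted union of a family of augmented sequences. -/
noncomputable def PermSeq.twisted (c : OrbitCocycle G Y S) (P : ∀ a, PermSeq (S a)) :
    PermSeq G where
  Δ i := Twisted c fun a => (P a).Δ i
  d i := Twisted.map c fun a => (P a).d i
  map_permAct i := Twisted.map_permAct _ fun a => (P a).map_permAct i
  d_comp i z := by
    have : Twisted.map c (fun a => (P a).d i) ∘ₗ Twisted.map c (fun a => (P a).d (i + 1)) = 0 := by
      refine Twisted.hom_ext fun a y x => ?_
      rw [LinearMap.comp_apply, Twisted.map_incl, Twisted.map_incl, (P a).d_comp, map_zero]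
      rfl
    exact LinearMap.congr_fun this z
  finite_stabilizer i t := Twisted.finite_stabilizer t ((P t.idx).finite_stabilizer i t.fib)
  exact_zero L hL z hz := Twisted.exists_map_eq _ (fun a => (P a).map_permAct 0) L hL z hz
    fun a y K hK h => (P a).exact_zero K hK _ h
  exact_succ i L hL z hz hdz :=
    Twisted.exists_map_eq _ (fun a => (P a).map_permAct (i + 1)) L hL z hz
      fun a y K hK h => (P a).exact_succ i K hK _ h (by
        have := Twisted.proj_map (c := c) (fun a => (P a).d i) a y z
        rw [← this, hdz, map_zero])

/-- Induction of resolutions of point stabilizers to a resolution of `ℤ[X]`. -/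
lemma PermSeq.exists_induced {X : Type} [MulAction G X] (S : X → Subgroup G)
    (hS : ∀ x, MulAction.stabilizer G x ≤ S x) {n : ℕ}
    (h : ∀ x, ∃ P : PermSeq (S x), P.LengthLE n ∧ Nonempty (Unique (P.Δ 0))) :
    ∃ (Q : PermSeq G) (e : Q.Δ 0 ≃ X), Q.LengthLE n ∧ ∀ (g : G) q, e (g • q) = g • e q := by
  choose P hP hu using h
  have hγ : ∀ (ω : MulAction.orbitRel.Quotient G X) (y : ω.orbit), ∃ g : G, g • ω.out = y.1 :=
    fun ω y => by
      have h := MulAction.orbitRel.Quotient.orbit_eq_orbit_out ω Quotient.out_eq'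
      exact h.subset y.2
  choose γ hγ using hγ
  let c : OrbitCocycle G (fun ω : MulAction.orbitRel.Quotient G X => ω.orbit)
      (fun ω => S ω.out) :=
    { val := fun ω g y => ⟨(γ ω (g • y))⁻¹ * g * γ ω y, hS _ (by
        rw [MulAction.mem_stabilizer_iff, mul_smul, mul_smul, inv_smul_eq_iff, hγ, hγ]
        rfl)⟩
      val_mul := fun ω g h y => Subtype.ext (by simp [mul_smul, mul_assoc])
      val_inj := fun ω g h y hg hh hgh => by
        have := congrArg Subtype.val hgh
        simpa [hg, hh] using this }
  let u : ∀ ω : MulAction.orbitRel.Quotient G X, Unique ((P ω.out).Δ 0) := fun ω => (hu _).some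
  refine ⟨PermSeq.twisted c fun ω => P ω.out,
    { toFun := fun t => (Twisted.base t).1
      invFun := fun x => ⟨⟦x⟧, ⟨x, MulAction.orbitRel.Quotient.mem_orbit.2 rfl⟩, default⟩
      left_inv := ?_
      right_inv := fun x => rfl }, fun i hi => ?_, fun g q => rfl⟩
  · rintro ⟨ω, ⟨x, hx⟩, t⟩
    obtain rfl := MulAction.orbitRel.Quotient.mem_orbit.1 hx
    exact congrArg (Twisted.mk _ _) (Subsingleton.elim _ _)
  · exact ⟨fun t => (hP _ i hi).elim t.fib⟩

end Induction

section Tree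

namespace SimpleGraph

variable {V : Type} {T : SimpleGraph V}

/-- In a tree, a vertex has at most one neighbour closer to a given vertex. -/
lemma IsTree.eq_of_adj_of_dist_eq (hT : T.IsTree) {x a b c : V} (hab : T.Adj a b)
    (hcb : T.Adj c b) (ha : T.dist x b = T.dist x a + 1) (hc : T.dist x b = T.dist x c + 1) :
    a = c := by
  obtain ⟨p, hp⟩ := hT.connected.exists_walk_length_eq_dist x a
  obtain ⟨q, hq⟩ := hT.connected.exists_walk_length_eq_dist x c
  have hp' := (p.concat hab).isPath_of_length_eq_dist (by rw [Walk.length_concat, hp, ha])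
  have hq' := (q.concat hcb).isPath_of_length_eq_dist (by rw [Walk.length_concat, hq, hc])
  have h := congrArg Subtype.val ((hT.isAcyclic.subsingleton_path x b).elim ⟨_, hp'⟩ ⟨_, hq'⟩)
  have h' := congrArg Walk.penultimate h
  simpa using h'

/-- On a tree, every antisymmetric function on edges is the coboundary of a function vanishing at
a given vertex. -/
lemma IsTree.exists_potential (hT : T.IsTree) {M : Type} [AddCommGroup M] (v₀ : V)
    (s : V → V → M) (hs : ∀ u v, T.Adj u v → s v u = -s u v) :
    ∃ h : V → M, h v₀ = 0 ∧ ∀ u v, T.Adj u v → h v - h u = s u v := by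
  have hπ : ∀ v, ∃ p, ∀ u, T.Adj u v → T.dist v₀ v = T.dist v₀ u + 1 → p = u := fun v => by
    by_cases h : ∃ u, T.Adj u v ∧ T.dist v₀ v = T.dist v₀ u + 1
    · obtain ⟨u, hu, hd⟩ := h
      exact ⟨u, fun u' hu' hd' => hT.eq_of_adj_of_dist_eq hu hu' hd hd'⟩
    · exact ⟨v, fun u hu hd => absurd ⟨u, hu, hd⟩ h⟩
  choose π hπ using hπ
  let H : ℕ → V → M := fun n => Nat.rec (fun _ => 0) (fun _ H v => H (π v) + s (π v) v) n
  have key : ∀ u v, T.Adj u v → T.dist v₀ v = T.dist v₀ u + 1 →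
      H (T.dist v₀ v) v - H (T.dist v₀ u) u = s u v := fun u v huv hd => by
    rw [hd]
    change H (T.dist v₀ u) (π v) + s (π v) v - H (T.dist v₀ u) u = s u v
    rw [hπ v u huv hd, add_sub_cancel_left]
  refine ⟨fun v => H (T.dist v₀ v) v, ?_, fun u v huv => ?_⟩
  · change H (T.dist v₀ v₀) v₀ = 0
    rw [dist_self]
    rfl
  · rcases hT.dist_eq_dist_add_one_of_adj v₀ huv with h | h
    · rw [← neg_sub, key v u huv.symm h, hs u v huv, neg_neg]
    · exact key u v huv h

lemma Connected.eq_of_adj {α : Type} (hT : T.Connected) {f : V → α}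
    (hf : ∀ u v, T.Adj u v → f u = f v) (u v : V) : f u = f v := by
  obtain ⟨p⟩ := hT.preconnected u v
  induction p with
  | nil => rfl
  | cons h _ ih => exact (hf _ _ h).trans ih

/-- Along a path, a strictly convex function that does not decrease in the first step is increasing
afterwards. -/
lemma Walk.IsPath.lt_of_convex {F : V → ℤ}
    (hF : ∀ a b c, T.Adj a b → T.Adj b c → a ≠ c → 2 * F b < F a + F c) {b d : V}
    (p : T.Walk b d) : ∀ {a : V} (h : T.Adj a b), (Walk.cons h p).IsPath → F a ≤ F b → b ≠ d →
      F b < F d := by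
  induction p with
  | nil => exact fun _ _ _ h => absurd rfl h
  | @cons b c d h' q ih =>
    intro a h hp hab _
    have hac : a ≠ c := by
      rintro rfl
      simp [Walk.cons_isPath_iff] at hp
    have hbc : F b < F c := by linarith [hF a b c h h' hac]
    by_cases hcd : c = d
    · rwa [← hcd]
    · exact hbc.trans (ih h' hp.of_cons hbc.le hcd)

end SimpleGraph

variable {G V : Type} [Group G] [MulAction G V] {T : SimpleGraph V}

lemma IsGTree.dist_smul (hT : IsGTree G V T) (g : G) (u v : V) :
    T.dist (g • u) (g • v) = T.dist u v := by
  have key : ∀ (g : G) (u v : V), T.dist (g • u) (g • v) ≤ T.dist u v := fun g u v => by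
    obtain ⟨p, hp⟩ := hT.isTree.connected.exists_walk_length_eq_dist u v
    let φ : T →g T := ⟨(g • ·), fun h => hT.adj_smul g _ _ h⟩
    have := SimpleGraph.dist_le (p.map φ)
    rwa [SimpleGraph.Walk.length_map, hp] at this
  refine (key g u v).antisymm ?_
  simpa using key g⁻¹ (g • u) (g • v)

/-- A finite group acting on a tree without inversions fixes a vertex. -/
lemma IsGTree.exists_fixed (hT : IsGTree G V T) (L : Subgroup G) (hL : Finite L) :
    ∃ v : V, ∀ g ∈ L, g • v = v := by
  have := Fintype.ofFinite L
  obtain ⟨v₀⟩ := hT.isTree.connected.nonempty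
  let F : V → ℤ := fun v => ∑ l : L, (T.dist (l.1 • v₀) v : ℤ) ^ 2
  have hF : ∀ a b c, T.Adj a b → T.Adj b c → a ≠ c → 2 * F b < F a + F c := by
    intro a b c hab hbc hac
    rw [← Finset.sum_add_distrib, Finset.mul_sum]
    refine Finset.sum_lt_sum_of_nonempty ⟨1, Finset.mem_univ _⟩ fun l _ => ?_
    have h1 := hT.isTree.dist_eq_dist_add_one_of_adj (l.1 • v₀) hab
    have h2 := hT.isTree.dist_eq_dist_add_one_of_adj (l.1 • v₀) hbc
    have h3 : ¬(T.dist (l.1 • v₀) b = T.dist (l.1 • v₀) a + 1 ∧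
        T.dist (l.1 • v₀) b = T.dist (l.1 • v₀) c + 1) := fun h =>
      hac (hT.isTree.eq_of_adj_of_dist_eq hab hbc.symm h.1 h.2)
    generalize T.dist (l.1 • v₀) a = x, T.dist (l.1 • v₀) b = y, T.dist (l.1 • v₀) c = z at *
    rcases h1 with h1 | h1
    · rcases h2 with h2 | h2
      · subst h2
        subst h1
        push_cast
        nlinarith
      · subst h1
        subst h2
        push_cast
        nlinarith [Int.natCast_nonneg y]
    · rcases h2 with h2 | h2
      · exact absurd ⟨h1, h2⟩ h3
      · obtain rfl : z = x + 2 := by omega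
        subst h1
        push_cast
        nlinarith
  have hFL : ∀ g ∈ L, ∀ v, F (g • v) = F v := fun g hg v => by
    refine (Fintype.sum_equiv (Equiv.mulLeft (⟨g, hg⟩ : L)) _ _ fun l => ?_).symm
    change _ = (T.dist ((g * l.1) • v₀) (g • v) : ℤ) ^ 2
    rw [mul_smul, hT.dist_smul]
  obtain ⟨m, hm⟩ : ∃ m, ∀ v, F m ≤ F v := by
    have h0 : ∀ v, 0 ≤ F v := fun v => Finset.sum_nonneg fun l _ => sq_nonneg _
    have hne := hT.isTree.connected.nonempty
    obtain ⟨m, hm⟩ := (InvImage.wf (fun v => (F v).toNat) Nat.lt_wfRel.wf).has_min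
      (Set.univ : Set V) Set.univ_nonempty
    refine ⟨m, fun v => ?_⟩
    have h1 : ¬ (F v).toNat < (F m).toNat := hm.2 v trivial
    have := h0 v
    omega
  have hadj : ∀ a b, F a = F m → F b = F m → a ≠ b → T.Adj a b := by
    intro a b ha hb hab
    obtain ⟨p, hp⟩ := (hT.isTree.connected.preconnected a b).exists_isPath
    cases p with
    | nil => exact absurd rfl hab
    | @cons _ c _ h q =>
      by_cases hcb : c = b
      · rwa [← hcb]
      · have := SimpleGraph.Walk.IsPath.lt_of_convex hF q h hp (ha.le.trans (hm c)) hcb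
        exact absurd (hm c) (by omega)
  refine ⟨m, fun g hg => ?_⟩
  by_contra hgm
  have h1 : T.Adj m (g • m) := hadj _ _ rfl (hFL g hg m) (Ne.symm hgm)
  have h2 : T.Adj (g • m) (g • g • m) := hT.adj_smul g _ _ h1
  have h3 : F (g • g • m) = F m := by rw [hFL g hg, hFL g hg]
  by_cases h : g • g • m = m
  · exact hT.no_inversion g m (g • m) h1 ⟨rfl, h⟩
  · have h4 := hF m (g • m) (g • g • m) h1 h2 (Ne.symm h)
    rw [h3, hFL g hg] at h4
    omega

/-- A tree with an action without inversions has an invariant orientation. -/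
lemma IsGTree.exists_orientation (hT : IsGTree G V T) :
    ∃ E : SubMulAction G (V × V), (∀ u v, (u, v) ∈ E → T.Adj u v ∧ (v, u) ∉ E) ∧
      ∀ u v, T.Adj u v → (u, v) ∈ E ∨ (v, u) ∈ E := by
  let q : V × V → MulAction.orbitRel.Quotient G (V × V) := fun p => ⟦p⟧
  have hq : ∀ (g : G) (p : V × V), q (g • p) = q p := fun g p => Quotient.sound ⟨g, rfl⟩
  have hne : ∀ u v, T.Adj u v → q (u, v) ≠ q (v, u) := fun u v huv h => by
    obtain ⟨g, hg⟩ := Quotient.exact h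
    have hg' : (g • v, g • u) = (u, v) := hg
    rw [Prod.mk.injEq] at hg'
    exact hT.no_inversion g u v huv ⟨hg'.2, hg'.1⟩
  refine ⟨⟨{p | T.Adj p.1 p.2 ∧ WellOrderingRel (q (p.1, p.2)) (q (p.2, p.1))},
    fun g p hp => ⟨hT.adj_smul g _ _ hp.1, ?_⟩⟩, fun u v h => ⟨h.1, fun h' => ?_⟩,
    fun u v h => ?_⟩
  · have := hp.2
    rwa [← hq g (p.1, p.2), ← hq g (p.2, p.1)] at this
  · exact asymm_of WellOrderingRel h.2 h'.2
  · rcases trichotomous_of WellOrderingRel (q (u, v)) (q (v, u)) with h' | h' | h'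
    · exact Or.inl ⟨h, h'⟩
    · exact absurd h' (hne u v h)
    · exact Or.inr ⟨h.symm, h'⟩

/-- The augmented cellular chain complex `0 → ℤ[E] → ℤ[V] → ℤ → 0` of a tree, with its exactness on
fixed points of finite subgroups. -/
lemma IsGTree.exists_chain_complex (hT : IsGTree G V T) :
    ∃ (E : SubMulAction G (V × V)) (φ : (E →₀ ℤ) →ₗ[ℤ] (V →₀ ℤ))
      (η : (V →₀ ℤ) →ₗ[ℤ] (Unit →₀ ℤ)) (_ : MulAction G Unit),
      (∀ (g : G) z, φ (permAct g z) = permAct g (φ z)) ∧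
      (∀ (g : G) z, η (permAct g z) = permAct g (η z)) ∧
      Function.Injective φ ∧ (∀ z, η (φ z) = 0) ∧
      (∀ L : Subgroup G, Finite L → ∀ z, (∀ g ∈ L, permAct g z = z) → η z = 0 →
        ∃ w, φ w = z ∧ ∀ g ∈ L, permAct g w = w) ∧
      ∀ L : Subgroup G, Finite L → ∀ z, (∀ g ∈ L, permAct g z = z) →
        ∃ w, η w = z ∧ ∀ g ∈ L, permAct g w = w := by
  classical
  obtain ⟨E, hE, hE'⟩ := hT.exists_orientation
  let _ : MulAction G Unit :=
    { smul := fun _ x => x, one_smul := fun _ => rfl, mul_smul := fun _ _ _ => rfl }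
  let φ : (E →₀ ℤ) →ₗ[ℤ] (V →₀ ℤ) := Finsupp.linearCombination ℤ fun e =>
    Finsupp.single e.1.2 1 - Finsupp.single e.1.1 1
  let η : (V →₀ ℤ) →ₗ[ℤ] (Unit →₀ ℤ) := Finsupp.lmapDomain ℤ ℤ fun _ => ()
  have hφ1 : ∀ e : E, φ (Finsupp.single e 1) =
      Finsupp.single e.1.2 1 - Finsupp.single e.1.1 1 := fun e => by simp [φ]
  have hη1 : ∀ v, η (Finsupp.single v 1) = Finsupp.single () 1 := fun v => by simp [η]
  have hφ : ∀ (g : G) z, φ (permAct g z) = permAct g (φ z) := fun g =>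
    map_permAct_of_single φ g fun e => by
      rw [hφ1, hφ1, map_sub, permAct_single, permAct_single]
      rfl
  have hη : ∀ (g : G) z, η (permAct g z) = permAct g (η z) := fun g =>
    map_permAct_of_single η g fun v => by
      rw [hη1, hη1, permAct_single]
  obtain ⟨s, hs⟩ : ∃ s : V → V → (E →₀ ℤ), ∀ e : E, s e.1.1 e.1.2 = Finsupp.single e 1 ∧
      s e.1.2 e.1.1 = -Finsupp.single e 1 := by
    refine ⟨fun u v => if h : (u, v) ∈ E then Finsupp.single ⟨(u, v), h⟩ 1 else
      if h : (v, u) ∈ E then -Finsupp.single ⟨(v, u), h⟩ 1 else 0, ?_⟩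
    rintro ⟨⟨u, v⟩, h⟩
    have h' := (hE u v h).2
    simp [h, h']
  have hs_ind : ∀ Q : V → V → Prop, (∀ e : E, Q e.1.1 e.1.2 ∧ Q e.1.2 e.1.1) →
      ∀ u v, T.Adj u v → Q u v := fun Q hQ u v huv => by
    rcases hE' u v huv with h | h
    · exact (hQ ⟨_, h⟩).1
    · exact (hQ ⟨_, h⟩).2
  have hs_anti : ∀ u v, T.Adj u v → s v u = -s u v := hs_ind _ fun e => by
    rw [(hs e).1, (hs e).2, neg_neg]
    exact ⟨rfl, rfl⟩
  have hs_act : ∀ (g : G) u v, T.Adj u v → permAct g (s u v) = s (g • u) (g • v) := fun g =>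
    hs_ind _ fun e => by
      rw [(hs e).1, (hs e).2, map_neg, permAct_single]
      exact ⟨(hs (g • e)).1.symm, (hs (g • e)).2.symm⟩
  have hφs : ∀ u v, T.Adj u v → φ (s u v) = Finsupp.single v 1 - Finsupp.single u 1 :=
    hs_ind _ fun e => by
      rw [(hs e).1, (hs e).2, map_neg, hφ1, neg_sub]
      exact ⟨rfl, rfl⟩
  have hpot : ∀ v₀, ∃ H : (V →₀ ℤ) →ₗ[ℤ] (E →₀ ℤ), H (Finsupp.single v₀ 1) = 0 ∧
      ∀ u v, T.Adj u v → H (Finsupp.single v 1) - H (Finsupp.single u 1) = s u v := fun v₀ => by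
    obtain ⟨h, h0, hh⟩ := hT.isTree.exists_potential v₀ s hs_anti
    exact ⟨Finsupp.linearCombination ℤ h, by simpa using h0, by simpa using hh⟩
  refine ⟨E, φ, η, inferInstance, hφ, hη, ?_, ?_, ?_, ?_⟩
  · obtain ⟨v₀⟩ := hT.isTree.connected.nonempty
    obtain ⟨H, -, hH⟩ := hpot v₀
    have : H ∘ₗ φ = LinearMap.id := by
      ext1 e
      ext1
      simp only [LinearMap.comp_apply, Finsupp.lsingle_apply, LinearMap.id_apply]
      rw [hφ1, map_sub, hH _ _ (hE _ _ e.2).1, (hs e).1]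
    exact Function.LeftInverse.injective (LinearMap.congr_fun this)
  · refine LinearMap.congr_fun (f := η ∘ₗ φ) (g := 0) ?_
    ext1 e
    ext1
    simp only [LinearMap.comp_apply, Finsupp.lsingle_apply]
    rw [hφ1, map_sub, hη1, hη1, sub_self]
    rfl
  · intro L hL z hz hηz
    obtain ⟨v₀, hv₀⟩ := hT.exists_fixed L hL
    obtain ⟨H, hH0, hH⟩ := hpot v₀
    refine ⟨H z, ?_, fun g hg => ?_⟩
    · obtain ⟨c, hc⟩ : ∃ c : (Unit →₀ ℤ) →ₗ[ℤ] (V →₀ ℤ),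
          c (Finsupp.single () 1) = Finsupp.single v₀ 1 :=
        ⟨Finsupp.lmapDomain ℤ ℤ fun _ => v₀, by simp⟩
      have : φ ∘ₗ H + c ∘ₗ η = LinearMap.id := by
        ext1 v
        ext1
        simp only [LinearMap.add_apply, LinearMap.comp_apply, Finsupp.lsingle_apply,
          LinearMap.id_apply, hη1, hc]
        have h := hT.isTree.connected.eq_of_adj
          (f := fun v => φ (H (Finsupp.single v 1)) - Finsupp.single v 1) (fun u v huv => by
            have := congrArg φ (hH u v huv)
            rw [hφs u v huv, map_sub] at this
            rw [sub_eq_sub_iff_sub_eq_sub, ← neg_sub, this, neg_sub]) v v₀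
        rw [hH0, map_zero, zero_sub] at h
        rw [← sub_eq_zero, add_sub_right_comm, h, neg_add_cancel]
      have := LinearMap.congr_fun this z
      simpa [hηz] using this
    · have : ∀ z, H (permAct g z) = permAct g (H z) := map_permAct_of_single H g fun v => by
        have h := hT.isTree.connected.eq_of_adj
          (f := fun v => H (Finsupp.single (g • v) 1) - permAct g (H (Finsupp.single v 1)))
          (fun u v huv => by
            have h1 := hH _ _ (hT.adj_smul g u v huv)
            have h2 := congrArg (permAct g) (hH u v huv)
            rw [hs_act g u v huv, ← h1, map_sub] at h2
            rw [sub_eq_sub_iff_sub_eq_sub, ← neg_sub, ← h2, neg_sub]) v v₀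
        rw [hv₀ g hg, hH0, map_zero, sub_zero] at h
        exact sub_eq_zero.1 h
      rw [← this, hz g hg]
  · intro L hL z hz
    obtain ⟨v₀, hv₀⟩ := hT.exists_fixed L hL
    refine ⟨Finsupp.single v₀ (z ()), ?_, fun g hg => by rw [permAct_single, hv₀ g hg]⟩
    ext
    simp [η]

end Tree

section Dimension

variable {G : Type} [Group G]

lemma exists_permSeq_of_fCd_le {n : ℕ} (h : fCd G ≤ (n : ℕ∞)) :
    ∃ P : PermSeq G, P.LengthLE n ∧ Nonempty (Unique (P.Δ 0)) := by
  have hne : {c : ℕ∞ | ∃ n : ℕ, c = n ∧ FcdLE G n}.Nonempty := by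
    by_contra hempty
    rw [fCd, Set.not_nonempty_iff_eq_empty.1 hempty, sInf_empty, top_le_iff] at h
    exact ENat.natCast_ne_top n h
  obtain ⟨m, hm, ⟨R⟩⟩ := csInf_mem hne
  obtain ⟨P, hP, hu⟩ := R.exists_permSeq
  have hmn : m ≤ n := ENat.natCast_le_natCast.1 (hm.symm.le.trans h)
  exact ⟨P, fun i hi => hP i (hmn.trans_lt hi), hu⟩

lemma fCd_le_of_fcdLE {n : ℕ} (h : FcdLE G n) : fCd G ≤ (n : ℕ∞) := sInf_le ⟨n, rfl, h⟩

/-- The isomorphism of permutation modules induced by an equivariant bijection. -/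
lemma exists_linearEquiv_of_equivariant {X Y : Type} [MulAction G X] [MulAction G Y] (e : X ≃ Y)
    (he : ∀ (g : G) x, e (g • x) = g • e x) :
    ∃ E : (X →₀ ℤ) ≃ₗ[ℤ] (Y →₀ ℤ), (∀ (g : G) z, E (permAct g z) = permAct g (E z)) ∧
      ∀ (g : G) z, E.symm (permAct g z) = permAct g (E.symm z) := by
  have h : ∀ (g : G) z, Finsupp.domLCongr (R := ℤ) (M := ℤ) e (permAct g z) =
      permAct g (Finsupp.domLCongr e z) := fun g =>
    map_permAct_of_single (Finsupp.domLCongr e).toLinearMap g fun x => by simp [he]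
  refine ⟨Finsupp.domLCongr e, h, fun g z => ?_⟩
  rw [LinearEquiv.symm_apply_eq, h, LinearEquiv.apply_symm_apply]

end Dimension

/-- If `G` acts on a tree with all vertex stabilizers of `F`-cohomological dimension
at most `n`, then `Fcd G ≤ n + 1`. -/
theorem fCd_le_of_gtree (G : Type) [Group G] (V : Type) [MulAction G V]
    (T : SimpleGraph V) (hT : IsGTree G V T) (n : ℕ)
    (hstab : ∀ v : V, fCd ↥(MulAction.stabilizer G v) ≤ (n : ℕ∞)) :
    fCd G ≤ ((n + 1 : ℕ) : ℕ∞) := by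
  have hres := fun v => exists_permSeq_of_fCd_le (hstab v)
  obtain ⟨E, φ, η, _, hφ, hη, φ_inj, hηφ, exact_left, exact_right⟩ := hT.exists_chain_complex
  obtain ⟨B, b, hB, hb⟩ := PermSeq.exists_induced (fun v : V => MulAction.stabilizer G v)
    (fun _ => le_rfl) hres
  obtain ⟨A, a, hA, ha⟩ := PermSeq.exists_induced
    (fun e : E => MulAction.stabilizer G e.1.1)
    (fun e g hg => congrArg (fun e' : E => e'.1.1) (MulAction.mem_stabilizer_iff.1 hg))
    fun e => hres e.1.1
  obtain ⟨a', ha', ha''⟩ := exists_linearEquiv_of_equivariant a ha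
  obtain ⟨b', hb', hb''⟩ := exists_linearEquiv_of_equivariant b hb
  obtain ⟨P, hP, hP0⟩ := A.exists_cone B Unit
    (b'.symm.toLinearMap ∘ₗ φ ∘ₗ a'.toLinearMap) (η ∘ₗ b'.toLinearMap)
    (fun g z => by simp [ha', hφ, hb'']) (fun g z => by simp [hb', hη])
    (b'.symm.injective.comp (φ_inj.comp a'.injective)) (fun z => by simp [hηφ])
    (fun L hL z hz hηz => by
      obtain ⟨w, hw, hwfix⟩ := exact_left L hL (b' z) (fun g hg => by rw [← hb', hz g hg]) hηz
      exact ⟨a'.symm w, by simp [hw], fun g hg => by rw [← ha'', hwfix g hg]⟩)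
    (fun L hL z hz => by
      obtain ⟨w, hw, hwfix⟩ := exact_right L hL z hz
      exact ⟨b'.symm w, by simp [hw], fun g hg => by rw [← hb'', hwfix g hg]⟩) hA hB
  let _ : Unique (P.Δ 0) := hP0 ▸ inferInstanceAs (Unique Unit)
  exact fCd_le_of_fcdLE (P.fcdLE hP)
end

section
/- Let G be a finitely generated group such that G is isomorphic to A × G for some infinite group A. Then G has infinite rational cohomological dimension: for no integer n ≥ 0 does the trivial ℚG-module ℚ have projective dimension at most n over ℚG. -/
open CategoryTheory

/-- `pd_R M ≤ n`: `M` admits a projective resolution of length at most `n`. -/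
def modulePdLE (R : Type) [Ring R] (M : ModuleCat R) (n : ℕ) : Prop :=
  ∃ P : ProjectiveResolution M, ∀ i : ℕ, n < i → Limits.IsZero (P.complex.X i)

/-- The trivial `ℚG`-module `ℚ`. -/
noncomputable def trivialQModule (G : Type) [Group G] : ModuleCat (MonoidAlgebra ℚ G) :=
  ModuleCat.of _ (Representation.trivial ℚ (G := G) (V := ℚ)).asModule

section ExtFunctoriality

open Abelian Limits

universe w w' w'' v v' v'' u u' u''

variable {C : Type u} [Category.{v} C] [Abelian C] [HasExt.{w} C]
variable {D : Type u'} [Category.{v'} D] [Abelian D] [HasExt.{w'} D]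
variable {E : Type u''} [Category.{v''} E] [Abelian E] [HasExt.{w''} E]

/-- With enough projectives, every class of positive degree is the pull-back of a class of smaller
degree along a connecting class. -/
theorem CategoryTheory.Abelian.Ext.exists_eq_extClass_comp [EnoughProjectives C] {X Y : C} {n : ℕ}
    (x : Ext.{w} X Y (n + 1)) :
    ∃ (K P : C) (i : K ⟶ P) (p : P ⟶ X) (h : i ≫ p = 0)
      (hS : (ShortComplex.mk i p h).ShortExact) (y : Ext.{w} K Y n),
      x = hS.extClass.comp y (add_comm 1 n) := by
  have hS : (ShortComplex.mk (kernel.ι (Projective.π X)) (Projective.π X)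
      (kernel.condition _)).ShortExact :=
    { exact := ShortComplex.exact_of_f_is_kernel _ (kernelIsKernel _) }
  have : Projective (ShortComplex.mk (kernel.ι (Projective.π X)) (Projective.π X)
      (kernel.condition _)).X₂ := inferInstanceAs (Projective (Projective.over X))
  obtain ⟨y, hy⟩ := Ext.contravariant_sequence_exact₃ hS Y x (Ext.eq_zero_of_projective _)
    (add_comm 1 n)
  exact ⟨_, _, _, _, _, hS, y, hy.symm⟩

/-- The maps induced on `Ext` by exact functors are natural in the functor. -/
theorem CategoryTheory.Abelian.Ext.mapExactFunctor_naturality [EnoughProjectives C] {F F' : C ⥤ D}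
    [F.Additive] [PreservesFiniteLimits F] [PreservesFiniteColimits F]
    [F'.Additive] [PreservesFiniteLimits F'] [PreservesFiniteColimits F']
    (τ : F ⟶ F') {X Y : C} {n : ℕ} (x : Ext.{w} X Y n) :
    (x.mapExactFunctor F).comp (Ext.mk₀ (τ.app Y)) (add_zero n) =
      (Ext.mk₀ (τ.app X)).comp (x.mapExactFunctor F') (zero_add n) := by
  induction n generalizing X with
  | zero =>
    obtain ⟨f, rfl⟩ := (Ext.mk₀_bijective X Y).2 x
    simp [Ext.mapExactFunctor_mk₀]
  | succ n ih =>
    obtain ⟨K, P, i, p, h, hS, y, rfl⟩ := Ext.exists_eq_extClass_comp x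
    have := ShortComplex.ShortExact.extClass_naturality (hS.map_of_exact F) (hS.map_of_exact F')
      ((ShortComplex.mk i p h).mapNatTrans τ)
    rw [Ext.mapExactFunctor_comp, Ext.mapExactFunctor_comp, Ext.comp_assoc_of_third_deg_zero, ih,
      ← Ext.comp_assoc _ _ _ (add_zero 1) (zero_add n) (by lia),
      ← Ext.comp_assoc _ _ _ (zero_add 1) (add_comm 1 n) (by lia),
      Ext.mapExactFunctor_extClass, Ext.mapExactFunctor_extClass]
    exact congrArg (fun t => Ext.comp t (y.mapExactFunctor F') (add_comm 1 n)) this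

/-- The map induced on `Ext` by a composition of exact functors. -/
theorem CategoryTheory.Abelian.Ext.mapExactFunctor_functor_comp [EnoughProjectives C]
    (F : C ⥤ D) (F' : D ⥤ E)
    [F.Additive] [PreservesFiniteLimits F] [PreservesFiniteColimits F]
    [F'.Additive] [PreservesFiniteLimits F'] [PreservesFiniteColimits F']
    [(F ⋙ F').Additive] [PreservesFiniteLimits (F ⋙ F')] [PreservesFiniteColimits (F ⋙ F')]
    {X Y : C} {n : ℕ} (x : Ext.{w} X Y n) :
    x.mapExactFunctor (F ⋙ F') = (x.mapExactFunctor F).mapExactFunctor F' := by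
  induction n generalizing X with
  | zero =>
    obtain ⟨f, rfl⟩ := (Ext.mk₀_bijective X Y).2 x
    simp only [Ext.mapExactFunctor_mk₀]
    rfl
  | succ n ih =>
    obtain ⟨K, P, i, p, h, hS, y, rfl⟩ := Ext.exists_eq_extClass_comp x
    rw [Ext.mapExactFunctor_comp, Ext.mapExactFunctor_comp, Ext.mapExactFunctor_comp, ih]
    refine congrArg (fun t => Ext.comp t _ (add_comm 1 n)) ?_
    refine (Ext.mapExactFunctor_extClass (F ⋙ F') hS).trans (Eq.symm ?_)
    rw [Ext.mapExactFunctor_extClass]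
    exact Ext.mapExactFunctor_extClass F' (hS.map_of_exact F)

/-- The identity functor induces the identity on `Ext`. -/
theorem CategoryTheory.Abelian.Ext.mapExactFunctor_functor_id [EnoughProjectives C]
    {X Y : C} {n : ℕ} (x : Ext.{w} X Y n) : x.mapExactFunctor (𝟭 C) = x := by
  induction n generalizing X with
  | zero =>
    obtain ⟨f, rfl⟩ := (Ext.mk₀_bijective X Y).2 x
    simp only [Ext.mapExactFunctor_mk₀]
    rfl
  | succ n ih =>
    obtain ⟨K, P, i, p, h, hS, y, rfl⟩ := Ext.exists_eq_extClass_comp x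
    simp only [Ext.mapExactFunctor_comp, ih, Ext.mapExactFunctor_extClass]
    rfl

/-- `Ext` vanishes in the degrees above the projective dimension. -/
theorem modulePdLE.ext_eq_zero {R : Type} [Ring R] {M N : ModuleCat.{0} R} {n i : ℕ}
    (h : modulePdLE R M n) (hi : n < i) (x : Ext.{0} M N i) : x = 0 := by
  obtain ⟨P, hP⟩ := h
  obtain ⟨f, hf, rfl⟩ := P.extMk_surjective x (i + 1) rfl
  obtain rfl : f = 0 := (hP i hi).eq_of_src _ _
  exact P.extMk_zero _ _

end ExtFunctoriality

section EquivariantMaps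

/-- An additive map between `ℚG`-modules commuting with the group elements is `ℚG`-linear. -/
noncomputable def equivariantLinearMap {G M N : Type*} [Group G] [AddCommGroup M]
    [Module (MonoidAlgebra ℚ G) M] [AddCommGroup N] [Module (MonoidAlgebra ℚ G) N]
    (f : M →+ N)
    (hf : ∀ g m, f (MonoidAlgebra.of ℚ G g • m) = MonoidAlgebra.of ℚ G g • f m) :
    M →ₗ[MonoidAlgebra ℚ G] N where
  toFun := f
  map_add' := f.map_add
  map_smul' r m := by
    let : Module ℚ M := Module.compHom M (algebraMap ℚ (MonoidAlgebra ℚ G))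
    let : Module ℚ N := Module.compHom N (algebraMap ℚ (MonoidAlgebra ℚ G))
    have hq (q : ℚ) (m : M) : f (algebraMap ℚ (MonoidAlgebra ℚ G) q • m) =
        algebraMap ℚ (MonoidAlgebra ℚ G) q • f m := map_rat_smul f q m
    simp only [RingHom.id_apply]
    induction r using MonoidAlgebra.induction_on generalizing m with
    | of g => exact hf g m
    | add a b ha hb => simp only [add_smul, map_add, ha, hb]
    | smul q r hr => rw [Algebra.smul_def, mul_smul, mul_smul, hq, hr]

theorem of_smul_trivialQModule {G : Type} [Group G] (g : G) (m : trivialQModule G) :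
    MonoidAlgebra.of ℚ G g • m = m := by
  refine (Representation.single_smul (Representation.trivial ℚ (G := G) (V := ℚ)) 1 g m).trans ?_
  rw [one_smul]
  rfl

end EquivariantMaps

section TranslationDifferences

open Finsupp

variable {A : Type*} [Group A]

/-- A finitely supported function invariant under right translations vanishes on an infinite
group. -/
theorem finsupp_eq_zero_of_forall_mapDomain_mul_right [Infinite A] {k : Type*} [AddCommMonoid k]
    {s : Set A} (hs : Subgroup.closure s = ⊤) {r : A →₀ k}
    (hr : ∀ a ∈ s, r.mapDomain (· * a) = r) : r = 0 := by
  have key (a : A) (x : A) : r (x * a) = r x := by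
    have ha : a ∈ Subgroup.closure s := hs ▸ Subgroup.mem_top a
    induction ha using Subgroup.closure_induction generalizing x with
    | mem a ha =>
      conv_lhs => rw [← hr a ha]
      exact mapDomain_apply (mul_left_injective a) r x
    | one => rw [mul_one]
    | mul a b _ _ iha ihb => rw [← mul_assoc, ihb, iha]
    | inv a _ ih => rw [← ih, inv_mul_cancel_right]
  obtain ⟨y, hy⟩ := Infinite.exists_notMem_finset r.support
  ext x
  rw [← key (x⁻¹ * y) x, mul_inv_cancel_left, notMem_support_iff.1 hy, coe_zero, Pi.zero_apply]

/-- On an infinite group generated by `s`, every function is a sum of differences of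
right translations by elements of `s`. -/
theorem exists_sum_translation_sub [Infinite A] (s : Finset A)
    (hs : Subgroup.closure (s : Set A) = ⊤) {W : Type*} [AddCommGroup W] [Module ℚ W]
    (f : A → W) : ∃ F : s → A → W, ∀ x, ∑ a, (F a (x * a) - F a x) = f x := by
  classical
  let ι : (A →₀ ℚ) →ₗ[ℚ] (s → A →₀ ℚ) :=
    LinearMap.pi fun a => lmapDomain ℚ ℚ (· * (a : A)) - LinearMap.id
  have hι : LinearMap.ker ι = ⊥ := by
    refine LinearMap.ker_eq_bot'.2 fun r hr =>
      finsupp_eq_zero_of_forall_mapDomain_mul_right hs fun a ha => ?_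
    exact sub_eq_zero.1 (congrFun hr ⟨a, ha⟩)
  obtain ⟨σ, hσ⟩ := ι.exists_leftInverse_of_injective hι
  let φ : (s → A →₀ ℚ) →ₗ[ℚ] W := (linearCombination ℚ f).comp σ
  refine ⟨fun a x => φ (Pi.single a (single x 1)), fun x => ?_⟩
  have hx : φ (ι (single x 1)) = f x := by
    have : σ (ι (single x 1)) = single x 1 := LinearMap.congr_fun hσ _
    simp [φ, this]
  rw [← hx, ← Finset.univ_sum_single (ι (single x 1)), map_sum]
  refine Finset.sum_congr rfl fun a _ => ?_
  rw [← map_sub, ← Pi.single_sub]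
  congr 2
  simp [ι]

end TranslationDifferences

section RestrictScalars

open Limits

universe u u' v

variable {R : Type u} [Ring R] {R' : Type u'} [Ring R'] (f : R →+* R')

theorem restrictScalars_map_exact (S : ShortComplex (ModuleCat.{v} R')) (h : S.Exact) :
    (S.map (ModuleCat.restrictScalars.{v} f)).Exact := by
  rw [ShortComplex.ShortExact.moduleCat_exact_iff_function_exact] at h ⊢
  exact h

instance restrictScalars_preservesFiniteLimits :
    PreservesFiniteLimits (ModuleCat.restrictScalars.{v} f) := by
  have := ((Functor.exact_tfae (ModuleCat.restrictScalars.{v} f)).out 1 3).mp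
    (restrictScalars_map_exact f)
  exact this.1

instance restrictScalars_preservesFiniteColimits :
    PreservesFiniteColimits (ModuleCat.restrictScalars.{v} f) := by
  have := ((Functor.exact_tfae (ModuleCat.restrictScalars.{v} f)).out 1 3).mp
    (restrictScalars_map_exact f)
  exact this.2

end RestrictScalars

section GroupRestriction

variable {H G : Type} [Group H] [Group G] (φ : H →* G)

/-- Restriction of `ℚG`-modules along a group homomorphism `H →* G`. -/
noncomputable abbrev groupRestriction :
    ModuleCat.{0} (MonoidAlgebra ℚ G) ⥤ ModuleCat.{0} (MonoidAlgebra ℚ H) :=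
  ModuleCat.restrictScalars (MonoidAlgebra.mapDomainRingHom ℚ φ)

theorem groupRestriction_of_smul {M : ModuleCat.{0} (MonoidAlgebra ℚ G)} (h : H)
    (m : (groupRestriction φ).obj M) :
    MonoidAlgebra.of ℚ H h • m = (MonoidAlgebra.of ℚ G (φ h) • (show M from m) : M) := by
  rw [ModuleCat.restrictScalars.smul_def]
  simp
  rfl

/-- Semi-equivariant additive maps are morphisms out of the restricted module. -/
noncomputable def groupRestrictionHom {M : ModuleCat.{0} (MonoidAlgebra ℚ G)}
    {N : ModuleCat.{0} (MonoidAlgebra ℚ H)} (f : M →+ N)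
    (hf : ∀ h m, f (MonoidAlgebra.of ℚ G (φ h) • m) = MonoidAlgebra.of ℚ H h • f m) :
    (groupRestriction φ).obj M ⟶ N :=
  ModuleCat.ofHom (X := (groupRestriction φ).obj M) <|
    equivariantLinearMap (M := (groupRestriction φ).obj M) (N := N)
      ⟨⟨f, f.map_zero⟩, f.map_add⟩ fun h m =>
        (congrArg f (groupRestriction_of_smul φ h m)).trans (hf h m)

/-- The action of an element centralizing the image of `φ` on the modules restricted along `φ`. -/
noncomputable def centralizerAction (c : G) (hc : ∀ h, Commute c (φ h)) :
    groupRestriction φ ⟶ groupRestriction φ where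
  app M := ModuleCat.ofHom (X := (groupRestriction φ).obj M) (Y := (groupRestriction φ).obj M) <|
    equivariantLinearMap (M := (groupRestriction φ).obj M) (N := (groupRestriction φ).obj M)
      (show M →+ M from DistribSMul.toAddMonoidHom M (MonoidAlgebra.of ℚ G c)) fun h m => by
        have key (m : M) : MonoidAlgebra.of ℚ G c • MonoidAlgebra.of ℚ G (φ h) • m =
            MonoidAlgebra.of ℚ G (φ h) • MonoidAlgebra.of ℚ G c • m := by
          rw [smul_smul, smul_smul, ← map_mul, ← map_mul, (hc h).eq]
        refine (congrArg _ (groupRestriction_of_smul φ h m)).trans ((key m).trans ?_)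
        exact (groupRestriction_of_smul φ h _).symm
  naturality M N f := by
    ext m
    exact (f.hom.map_smul _ _).symm

theorem centralizerAction_app_apply (c : G) (hc : ∀ h, Commute c (φ h))
    {M : ModuleCat.{0} (MonoidAlgebra ℚ G)} (m : M) :
    (show M from (centralizerAction φ c hc).app M m) = MonoidAlgebra.of ℚ G c • m := rfl

end GroupRestriction

section Functions

variable {Γ A G : Type} [Group Γ] [Group A] [Group G] (e : Γ ≃* A × G)

/-- The representation of `Γ ≅ A × G` on functions from `A` to a `G`-module `W`. -/
noncomputable def functionRep (W : Type) [AddCommGroup W] [Module ℚ W]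
    [Module (MonoidAlgebra ℚ G) W] : Representation ℚ Γ (A → W) where
  toFun g :=
    { toFun := fun f x => MonoidAlgebra.of ℚ G (e g).2 • f ((e g).1⁻¹ * x)
      map_add' := fun f f' => funext fun x => smul_add _ _ _
      map_smul' := fun q f => funext fun x =>
        map_rat_smul (DistribSMul.toAddMonoidHom W (MonoidAlgebra.of ℚ G (e g).2)) q _ }
  map_one' := by
    ext1 f
    funext x
    simp [← MonoidAlgebra.one_def]
  map_mul' g h := by
    ext1 f
    funext x
    simp only [map_mul, Prod.snd_mul, Prod.fst_mul, mul_smul, mul_inv_rev, mul_assoc]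
    rfl

/-- The functions from `A` to a `G`-module `W`, as a module over `Γ ≅ A × G`. -/
noncomputable def functionModule (W : ModuleCat.{0} (MonoidAlgebra ℚ G)) :
    ModuleCat.{0} (MonoidAlgebra ℚ Γ) :=
  letI : Module ℚ W := Module.compHom W (algebraMap ℚ (MonoidAlgebra ℚ G))
  ModuleCat.of _ (functionRep e W).asModule

variable (W : ModuleCat.{0} (MonoidAlgebra ℚ G))

/-- The elements of `functionModule e W` are the functions from `A` to `W`. -/
noncomputable def functionModuleEquiv : functionModule e W ≃+ (A → W) :=
  letI : Module ℚ W := Module.compHom W (algebraMap ℚ (MonoidAlgebra ℚ G))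
  (functionRep e W).asModuleEquiv.toAddEquiv

theorem functionModuleEquiv_of_smul (g : Γ) (f : functionModule e W) (x : A) :
    functionModuleEquiv e W (MonoidAlgebra.of ℚ Γ g • f) x =
      MonoidAlgebra.of ℚ G (e g).2 • functionModuleEquiv e W f ((e g).1⁻¹ * x) := by
  let : Module ℚ W := Module.compHom W (algebraMap ℚ (MonoidAlgebra ℚ G))
  have := Representation.single_smul (functionRep e W) 1 g f
  rw [one_smul] at this
  exact congrFun this x

/-- Inflation of `G`-modules to `Γ ≅ A × G`. -/
noncomputable abbrev inflation :
    ModuleCat.{0} (MonoidAlgebra ℚ G) ⥤ ModuleCat.{0} (MonoidAlgebra ℚ Γ) :=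
  groupRestriction ((MonoidHom.snd A G).comp e.toMonoidHom)

/-- Restriction of modules over `Γ ≅ A × G` to `G`. -/
noncomputable abbrev restriction :
    ModuleCat.{0} (MonoidAlgebra ℚ Γ) ⥤ ModuleCat.{0} (MonoidAlgebra ℚ G) :=
  groupRestriction (e.symm.toMonoidHom.comp (MonoidHom.inr A G))

/-- The inclusion of the constant functions. -/
noncomputable def constMap : (inflation e).obj W ⟶ functionModule e W :=
  groupRestrictionHom _
    ((functionModuleEquiv e W).symm.toAddMonoidHom.comp (Pi.constAddMonoidHom A W)) fun g m => by
      apply (functionModuleEquiv e W).injective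
      funext x
      rw [functionModuleEquiv_of_smul]
      simp

/-- Evaluation of functions at `1`. -/
noncomputable def evalOne : (restriction e).obj (functionModule e W) ⟶ W :=
  groupRestrictionHom _
    ((Pi.evalAddMonoidHom (fun _ : A => W) 1).comp (functionModuleEquiv e W).toAddMonoidHom)
    fun g m => by
      refine (functionModuleEquiv_of_smul e W _ _ _).trans ?_
      simp

/-- Restricting an inflated module gives back the module. -/
noncomputable def inflationRestriction : inflation e ⋙ restriction e ⟶ 𝟭 _ where
  app X := groupRestrictionHom _ (M := (inflation e).obj X) (N := X)
    ⟨⟨id, rfl⟩, fun _ _ => rfl⟩ fun g m => by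
      refine (groupRestriction_of_smul _ _ _).trans ?_
      simp
      rfl

/-- The action of an element of `A` on the restrictions to `G` of the modules over `A × G`. -/
noncomputable def leftAction (a : A) : restriction e ⟶ restriction e :=
  centralizerAction _ (e.symm (a, 1)) fun g => by
    simp [Commute, SemiconjBy, ← map_mul]

/-- The sum of the differences of the right translations by the elements of `s`, on families of
functions. -/
def translationDifferenceHom {A : Type*} [Group A] (s : Finset A) (W : Type*) [AddCommGroup W] :
    (s → A → W) →+ (A → W) where
  toFun F x := ∑ a, (F a (x * a) - F a x)
  map_zero' := by
    funext x
    simp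
  map_add' F F' := by
    funext x
    simp only [Pi.add_apply, add_sub_add_comm, Finset.sum_add_distrib]

theorem functionModuleEquiv_translationDifferenceHom (s : Finset A) (g : Γ)
    (F : s → functionModule e W) :
    (translationDifferenceHom s W fun a => functionModuleEquiv e W (MonoidAlgebra.of ℚ Γ g • F a)) =
      functionModuleEquiv e W (MonoidAlgebra.of ℚ Γ g • (functionModuleEquiv e W).symm
        (translationDifferenceHom s W fun a => functionModuleEquiv e W (F a))) := by
  funext x
  simp [-MonoidAlgebra.of_apply, functionModuleEquiv_of_smul, Finset.smul_sum, smul_sub,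
    mul_assoc, translationDifferenceHom]

/-- The map `translationDifferenceHom`, as a morphism of modules over `Γ ≅ A × G`. -/
noncomputable def translationDifference (s : Finset A) :
    ModuleCat.of (MonoidAlgebra ℚ Γ) (s → functionModule e W) ⟶ functionModule e W :=
  ModuleCat.ofHom (Y := functionModule e W) <| equivariantLinearMap (N := functionModule e W)
    ((functionModuleEquiv e W).symm.toAddMonoidHom.comp
      ((translationDifferenceHom s W).comp
        ((functionModuleEquiv e W).toAddMonoidHom.compLeft s)))
    fun g F => (functionModuleEquiv e W).symm_apply_eq.2
      (functionModuleEquiv_translationDifferenceHom e W s g F)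

theorem functionModuleEquiv_translationDifference (s : Finset A)
    (F : s → functionModule e W) (x : A) :
    functionModuleEquiv e W (translationDifference e W s F) x =
      ∑ a, (functionModuleEquiv e W (F a) (x * a) - functionModuleEquiv e W (F a) x) := by
  refine (congrFun ((functionModuleEquiv e W).apply_symm_apply _) x).trans ?_
  rfl

theorem translationDifference_surjective [Infinite A] {s : Finset A}
    (hs : Subgroup.closure (s : Set A) = ⊤) :
    Function.Surjective (translationDifference e W s) := by
  intro f
  let : Module ℚ W := Module.compHom W (algebraMap ℚ (MonoidAlgebra ℚ G))
  obtain ⟨F, hF⟩ := exists_sum_translation_sub s hs (functionModuleEquiv e W f)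
  refine ⟨fun a => (functionModuleEquiv e W).symm (F a), (functionModuleEquiv e W).injective ?_⟩
  funext x
  rw [functionModuleEquiv_translationDifference, ← hF]
  simp

theorem translationDifference_evalOne (s : Finset A) :
    (restriction e).map (translationDifference e W s) ≫ evalOne e W =
      ∑ a : s, ((leftAction e (a : A)⁻¹).app _ - 𝟙 _) ≫
        (restriction e).map (ModuleCat.ofHom (LinearMap.proj a)) ≫ evalOne e W := by
  ext F
  refine (functionModuleEquiv_translationDifference e W s F 1).trans ?_
  rw [ModuleCat.hom_sum, LinearMap.sum_apply]
  refine Finset.sum_congr rfl fun a _ => ?_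
  rw [Preadditive.sub_comp, ModuleCat.hom_sub, LinearMap.sub_apply]
  refine congrArg₂ _ (Eq.symm ?_) rfl
  refine (functionModuleEquiv_of_smul e W (e.symm ((a : A)⁻¹, 1)) (F a) 1).trans ?_
  simp [← MonoidAlgebra.one_def]

theorem constMap_evalOne :
    (restriction e).map (constMap e W) ≫ evalOne e W = (inflationRestriction e).app W := by
  ext w
  exact congrFun ((functionModuleEquiv e W).apply_symm_apply (fun _ : A => (show W from w))) 1

end Functions

section Descent

open Abelian

variable {Γ A G : Type} [Group Γ] [Group A] [Group G]

theorem leftAction_app_trivialQModule (e : Γ ≃* A × G) (a : A) :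
    (leftAction e a).app (trivialQModule Γ) = 𝟙 _ := by
  ext m
  exact of_smul_trivialQModule _ (show trivialQModule Γ from m)

/-- The inflation of the trivial module is trivial. -/
noncomputable def trivialToInflation (e : Γ ≃* A × G) :
    trivialQModule Γ ⟶ (inflation e).obj (trivialQModule G) :=
  ModuleCat.ofHom (Y := (inflation e).obj (trivialQModule G)) <|
    equivariantLinearMap (M := trivialQModule Γ) (N := (inflation e).obj (trivialQModule G))
      (show ℚ →+ ℚ from AddMonoidHom.id ℚ) fun g m => by
        refine (of_smul_trivialQModule g m).trans (Eq.symm ?_)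
        refine (groupRestriction_of_smul _ (M := trivialQModule G) g m).trans ?_
        exact of_smul_trivialQModule (G := G) _ _

/-- The composite comparison between the restriction of the trivial module and the trivial
module. -/
noncomputable def trivialComparison (e : Γ ≃* A × G) :
    (restriction e).obj (trivialQModule Γ) ⟶ trivialQModule G :=
  (restriction e).map (trivialToInflation e) ≫ (inflationRestriction e).app _

instance (e : Γ ≃* A × G) : IsIso (trivialComparison e) := by
  rw [ConcreteCategory.isIso_iff_bijective]
  exact Function.bijective_id

/-- If all classes of degree `d + 1` of the trivial module of `Γ ≅ A × G` vanish, with `A` infinite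
and finitely generated, then the classes of degree `d` of the trivial module of `G` vanish. -/
theorem ext_trivialQModule_eq_zero_of_succ (e : Γ ≃* A × G) [Infinite A] {s : Finset A}
    (hs : Subgroup.closure (s : Set A) = ⊤) {d : ℕ}
    (h : ∀ (K : ModuleCat.{0} (MonoidAlgebra ℚ Γ)) (x : Ext.{0} (trivialQModule Γ) K (d + 1)),
      x = 0)
    (W : ModuleCat.{0} (MonoidAlgebra ℚ G)) (x : Ext.{0} (trivialQModule G) W d) : x = 0 := by
  let D := translationDifference e W s
  have : Epi D := (ModuleCat.epi_iff_surjective _).2 (translationDifference_surjective e W hs)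
  have hS : (ShortComplex.mk (Limits.kernel.ι D) D (Limits.kernel.condition _)).ShortExact :=
    { exact := ShortComplex.exact_of_f_is_kernel _ (Limits.kernelIsKernel _) }
  obtain ⟨z, hz⟩ := Ext.covariant_sequence_exact₃ (trivialQModule Γ) hS
    ((Ext.mk₀ (trivialToInflation e)).comp ((x.mapExactFunctor (inflation e)).comp
      (Ext.mk₀ (constMap e W)) (add_zero d)) (zero_add d)) rfl (h _ _)
  have key := congrArg
    (fun t => (t.mapExactFunctor (restriction e)).comp (Ext.mk₀ (evalOne e W)) (add_zero d)) hz
  have hleft : ((z.comp (Ext.mk₀ D) (add_zero d)).mapExactFunctor (restriction e)).comp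
      (Ext.mk₀ (evalOne e W)) (add_zero d) = 0 := by
    rw [Ext.mapExactFunctor_comp, Ext.mapExactFunctor_mk₀, Ext.comp_assoc_of_third_deg_zero,
      Ext.mk₀_comp_mk₀, translationDifference_evalOne, Ext.mk₀_sum, Ext.comp_sum]
    refine Finset.sum_eq_zero fun a _ => ?_
    rw [← Ext.mk₀_comp_mk₀, ← Ext.comp_assoc_of_third_deg_zero, sub_eq_add_neg,
      Ext.mk₀_add, Ext.mk₀_neg, Ext.comp_add, Ext.comp_neg, Ext.mapExactFunctor_naturality,
      leftAction_app_trivialQModule, Ext.mk₀_id_comp, Ext.comp_mk₀_id, add_neg_cancel,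
      Ext.zero_comp]
  have hright : (x.mapExactFunctor (inflation e ⋙ restriction e)).comp
      (Ext.mk₀ ((inflationRestriction e).app W)) (add_zero d) =
        (Ext.mk₀ ((inflationRestriction e).app (trivialQModule G))).comp x (zero_add d) := by
    rw [Ext.mapExactFunctor_naturality, Ext.mapExactFunctor_functor_id]
  have hzero : (Ext.mk₀ (trivialComparison e)).comp x (zero_add d) = 0 := by
    rw [← hleft, key, Ext.mapExactFunctor_comp, Ext.mapExactFunctor_comp, Ext.mapExactFunctor_mk₀,
      Ext.mapExactFunctor_mk₀, Ext.comp_assoc_of_third_deg_zero, Ext.comp_assoc_of_third_deg_zero,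
      Ext.mk₀_comp_mk₀, constMap_evalOne, ← Ext.mapExactFunctor_functor_comp, hright,
      trivialComparison, ← Ext.mk₀_comp_mk₀, Ext.comp_assoc_of_second_deg_zero]
  have := congrArg (fun t => (Ext.mk₀ (inv (trivialComparison e))).comp t (zero_add d)) hzero
  simpa [← Ext.comp_assoc_of_second_deg_zero] using this

end Descent

/-- Let `G` be a finitely generated group isomorphic to `A × G` for some infinite
group `A`.  Then `G` has infinite rational cohomological dimension: for no `n ≥ 0`
does the trivial `ℚG`-module `ℚ` have projective dimension at most `n`. -/
theorem rational_cd_infinite_of_selfSimilar (G A : Type) [Group G] [Group A]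
    (hfg : Group.FG G) (hA : Infinite A) (e : G ≃* A × G) :
    ∀ n : ℕ, ¬ modulePdLE (MonoidAlgebra ℚ G) (trivialQModule G) n := by
  intro n hn
  obtain ⟨s, hs⟩ : Group.FG A :=
    haveI := hfg
    Group.fg_of_surjective (f := (MonoidHom.fst A G).comp e.toMonoidHom)
      (Prod.fst_surjective.comp e.surjective)
  have key (d : ℕ) (h : ∀ (K : ModuleCat.{0} (MonoidAlgebra ℚ G))
      (x : Abelian.Ext.{0} (trivialQModule G) K d), x = 0) (x : trivialQModule G) : x = 0 := by
    induction d with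
    | zero =>
      have := (Abelian.Ext.mk₀_eq_zero_iff _).1 (h _ (Abelian.Ext.mk₀ (𝟙 (trivialQModule G))))
      exact congrArg (fun f => f.hom x) this
    | succ d ih => exact ih (ext_trivialQModule_eq_zero_of_succ e hs h)
  have h_one := key (n + 1) (fun _ => hn.ext_eq_zero n.lt_succ_self) (show ℚ from 1)
  exact one_ne_zero (α := ℚ) h_one
end

section
/- Let A be the group given by the presentation ⟨a, b | b³ = 1, a⁻¹ b a = b⁻¹⟩ (a presented group on two generators with relator words b³ and a⁻¹bab). Then every finite subgroup of A has order at most 3. -/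
/-- The relators `b³` and `a⁻¹bab` in the free group on two generators `a, b`
(here `a = FreeGroup.of 0` and `b = FreeGroup.of 1`). -/
def dunwoodyRels : Set (FreeGroup (Fin 2)) :=
  {(FreeGroup.of 1) ^ 3,
   (FreeGroup.of 0)⁻¹ * FreeGroup.of 1 * FreeGroup.of 0 * FreeGroup.of 1}

namespace DunwoodyGroup

/-- The image of the generator `a`. -/
def a : PresentedGroup dunwoodyRels := PresentedGroup.of 0

/-- The image of the generator `b`. -/
def b : PresentedGroup dunwoodyRels := PresentedGroup.of 1

theorem b_pow_three : b ^ 3 = 1 :=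
  PresentedGroup.one_of_mem (rels := dunwoodyRels) (x := FreeGroup.of 1 ^ 3) (Or.inl rfl)

theorem a_inv_mul_b_mul_a_mul_b : a⁻¹ * b * a * b = 1 :=
  PresentedGroup.one_of_mem (rels := dunwoodyRels)
    (x := (FreeGroup.of 0)⁻¹ * FreeGroup.of 1 * FreeGroup.of 0 * FreeGroup.of 1) (Or.inr rfl)

theorem a_mul_b_mul_a_inv : a * b * a⁻¹ = b⁻¹ := by
  have h : a⁻¹ * b * a = b⁻¹ := eq_inv_of_mul_eq_one_left a_inv_mul_b_mul_a_mul_b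
  calc a * b * a⁻¹ = a * (b⁻¹)⁻¹ * a⁻¹ := by rw [inv_inv]
    _ = a * (a⁻¹ * b * a)⁻¹ * a⁻¹ := by rw [h]
    _ = b⁻¹ := by group

theorem conj_b (g : PresentedGroup dunwoodyRels) :
    g * b * g⁻¹ = b ∨ g * b * g⁻¹ = b⁻¹ := by
  have hg : g ∈ Subgroup.closure (Set.range (PresentedGroup.of (rels := dunwoodyRels))) := by
    simp [PresentedGroup.closure_range_of]
  induction hg using Subgroup.closure_induction with
  | mem x hx =>
    obtain ⟨i, rfl⟩ := hx
    fin_cases i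
    · exact Or.inr a_mul_b_mul_a_inv
    · exact Or.inl (mul_inv_cancel_right b b)
  | one => simp
  | mul x y _ _ hx hy =>
    simp only [← MulAut.conj_apply, map_mul, MulAut.mul_apply] at hx hy ⊢
    rcases hy with hy | hy <;> rcases hx with hx | hx <;> simp only [hy, map_inv, hx] <;> simp
  | inv x _ hx =>
    simp only [← MulAut.conj_apply, map_inv] at hx ⊢
    rcases hx with hx | hx
    · exact Or.inl (by rw [MulAut.inv_apply, MulEquiv.symm_apply_eq, hx])
    · exact Or.inr (by rw [MulAut.inv_apply, MulEquiv.symm_apply_eq, map_inv, hx, inv_inv])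

instance normal_zpowers_b : (Subgroup.zpowers b).Normal where
  conj_mem := by
    rintro _ ⟨n, rfl⟩ g
    simp only [← conj_zpow]
    apply Subgroup.zpow_mem
    rcases conj_b g with h | h <;> simp [h]

/-- The exponent sum of `a`. -/
def exponentSum : PresentedGroup dunwoodyRels →* Multiplicative ℤ :=
  PresentedGroup.toGroup (f := ![Multiplicative.ofAdd 1, 1]) (by
    rintro r (rfl | rfl) <;> simp)

theorem ker_exponentSum_le : exponentSum.ker ≤ Subgroup.zpowers b := by
  have h : (zpowersHom _ (QuotientGroup.mk' (Subgroup.zpowers b) a)).comp exponentSum =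
      QuotientGroup.mk' (Subgroup.zpowers b) := by
    refine PresentedGroup.ext (Fin.forall_fin_two.2 ⟨?_, ?_⟩)
    · simp [exponentSum, a]
    · have hb : QuotientGroup.mk' (Subgroup.zpowers b) (PresentedGroup.of 1) = 1 :=
        (QuotientGroup.eq_one_iff b).2 (Subgroup.mem_zpowers b)
      rw [hb]
      simp [exponentSum]
  intro g hg
  rw [← QuotientGroup.eq_one_iff, ← QuotientGroup.mk'_apply, ← h, MonoidHom.comp_apply,
    MonoidHom.mem_ker.1 hg, map_one]

end DunwoodyGroup

open DunwoodyGroup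

/-- Every finite subgroup of the presented group
`A = ⟨a, b ∣ b³ = 1, a⁻¹ba = b⁻¹⟩` has order at most `3`. -/
theorem finite_subgroups_card_le_three (K : Subgroup (PresentedGroup dunwoodyRels))
    (hK : Finite K) : Nat.card K ≤ 3 := by
  have hle : K ≤ Subgroup.zpowers b := by
    refine le_trans (fun g hg => ?_) ker_exponentSum_le
    have hfin : IsOfFinOrder g :=
      K.subtype.isOfFinOrder (isOfFinOrder_of_finite (⟨g, hg⟩ : K))
    exact (isOfFinOrder_iff_eq_one _).1 (exponentSum.isOfFinOrder hfin)
  have hb : IsOfFinOrder b := isOfFinOrder_iff_pow_eq_one.2 ⟨3, by norm_num, b_pow_three⟩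
  have : Finite (Subgroup.zpowers b) := hb.finite_zpowers
  calc Nat.card K ≤ Nat.card (Subgroup.zpowers b) := Subgroup.card_le_of_le hle
    _ = orderOf b := Nat.card_zpowers b
    _ ≤ 3 := orderOf_le_of_pow_eq_one (by norm_num) b_pow_three
end

section
/- Every countable locally finite group G acts on a tree with finite stabilizers: there exists a G-tree T such that every vertex stabilizer G_v is finite. -/
/-- The graph joining each vertex `v` to its parent `p v`. -/
def parentGraph {V : Type*} (p : V → V) : SimpleGraph V :=
  SimpleGraph.fromRel fun u v => p u = v

section ParentGraph

variable {V : Type*} {p : V → V} {level : V → ℕ}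

theorem level_iterate (hp : ∀ v, level (p v) = level v + 1) (k : ℕ) (v : V) :
    level (p^[k] v) = level v + k := by
  induction k with
  | zero => simp
  | succ k ih => rw [Function.iterate_succ_apply', hp, ih, add_assoc]

theorem parentGraph_adj_iff (hp : ∀ v, level (p v) = level v + 1) {u v : V} :
    (parentGraph p).Adj u v ↔ p u = v ∨ p v = u := by
  rw [parentGraph, SimpleGraph.fromRel_adj, and_iff_right_iff_imp]
  rintro h rfl
  have := hp u
  grind

theorem parentGraph_reachable_iterate (hp : ∀ v, level (p v) = level v + 1) (k : ℕ) (v : V) :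
    (parentGraph p).Reachable v (p^[k] v) := by
  induction k with
  | zero => rfl
  | succ k ih =>
    rw [Function.iterate_succ_apply']
    exact ih.trans ((parentGraph_adj_iff hp).2 (Or.inl rfl)).reachable

/-- No path avoiding the edge from `v` to its parent leaves the set of descendants of `v`. -/
theorem not_reachable_parent_deleteEdges (hp : ∀ v, level (p v) = level v + 1) (v : V) :
    ¬((parentGraph p).deleteEdges {s(v, p v)}).Reachable v (p v) := by
  rintro ⟨w⟩
  have descendant : ∀ {x y : V}, ((parentGraph p).deleteEdges {s(v, p v)}).Walk x y →
      (∃ k, p^[k] x = v) → ∃ k, p^[k] y = v := by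
    intro x y w
    induction w with
    | nil => exact id
    | cons h _ ih =>
      rintro ⟨k, hk⟩
      apply ih
      rw [SimpleGraph.deleteEdges_adj, parentGraph_adj_iff hp] at h
      obtain ⟨rfl | rfl, hne⟩ := h
      · cases k with
        | zero =>
          obtain rfl : _ = v := hk
          exact absurd rfl hne
        | succ k => exact ⟨k, hk⟩
      · exact ⟨k + 1, hk⟩
  obtain ⟨k, hk⟩ := descendant w ⟨0, rfl⟩
  have := level_iterate hp k (p v)
  rw [hk, hp] at this
  omega

theorem parentGraph_isAcyclic (hp : ∀ v, level (p v) = level v + 1) :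
    (parentGraph p).IsAcyclic := by
  rw [SimpleGraph.isAcyclic_iff_forall_adj_isBridge]
  intro u v h
  rcases (parentGraph_adj_iff hp).1 h with rfl | rfl
  · exact SimpleGraph.isBridge_iff.2 (not_reachable_parent_deleteEdges hp u)
  · rw [Sym2.eq_swap]
    exact SimpleGraph.isBridge_iff.2 (not_reachable_parent_deleteEdges hp v)

theorem parentGraph_isTree [Nonempty V] (hp : ∀ v, level (p v) = level v + 1)
    (hmeet : ∀ u v, ∃ k l, p^[k] u = p^[l] v) : (parentGraph p).IsTree where
  isAcyclic := parentGraph_isAcyclic hp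
  connected :=
    { preconnected := fun u v => by
        obtain ⟨k, l, h⟩ := hmeet u v
        have hu := parentGraph_reachable_iterate hp k u
        rw [h] at hu
        exact hu.trans (parentGraph_reachable_iterate hp l v).symm }

end ParentGraph

/-- A countable locally finite group is the union of an increasing sequence of finite subgroups. -/
theorem exists_monotone_finite_subgroups (G : Type*) [Group G] [Countable G]
    (hLF : ∀ H : Subgroup G, H.FG → Finite H) :
    ∃ H : ℕ → Subgroup G, Monotone H ∧ (∀ n, Finite (H n)) ∧ ∀ g, ∃ n, g ∈ H n := by
  obtain ⟨f, hf⟩ := exists_surjective_nat G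
  refine ⟨fun n => Subgroup.closure (f '' Set.Iic n), fun m n h => ?_, fun n => ?_, fun g => ?_⟩
  · exact Subgroup.closure_mono (Set.image_mono (Set.Iic_subset_Iic.2 h))
  · exact hLF _ ((Subgroup.fg_iff _).2 ⟨_, rfl, (Set.finite_Iic n).image f⟩)
  · obtain ⟨n, rfl⟩ := hf g
    exact ⟨n, Subgroup.subset_closure ⟨n, Set.mem_Iic.2 le_rfl, rfl⟩⟩

section CosetTree

variable {G : Type*} [Group G] {H : ℕ → Subgroup G}

/-- The map sending a coset `g H n` to the coset `g H (n + 1)` containing it. -/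
def cosetParent (hH : Monotone H) (v : Σ n, G ⧸ H n) : Σ n, G ⧸ H n :=
  ⟨v.1 + 1, Subgroup.quotientMapOfLE (hH v.1.le_succ) v.2⟩

theorem cosetParent_smul (hH : Monotone H) (g : G) (v : Σ n, G ⧸ H n) :
    cosetParent hH (g • v) = g • cosetParent hH v := by
  obtain ⟨n, x⟩ := v
  induction x using QuotientGroup.induction_on
  rfl

theorem iterate_cosetParent (hH : Monotone H) (k n : ℕ) (g : G) :
    (cosetParent hH)^[k] ⟨n, (g : G ⧸ H n)⟩ = ⟨n + k, (g : G ⧸ H (n + k))⟩ := by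
  induction k with
  | zero => rfl
  | succ k ih =>
    rw [Function.iterate_succ_apply', ih]
    rfl

theorem exists_iterate_cosetParent_eq (hH : Monotone H) (hG : ∀ g, ∃ n, g ∈ H n)
    (u v : Σ n, G ⧸ H n) : ∃ k l, (cosetParent hH)^[k] u = (cosetParent hH)^[l] v := by
  obtain ⟨m, x⟩ := u
  obtain ⟨n, y⟩ := v
  induction x using QuotientGroup.induction_on with | H a
  induction y using QuotientGroup.induction_on with | H b
  obtain ⟨r, hr⟩ := hG (a⁻¹ * b)
  refine ⟨n + r, m + r, ?_⟩
  rw [iterate_cosetParent, iterate_cosetParent, show n + (m + r) = m + (n + r) by omega]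
  congr 1
  exact QuotientGroup.eq.2 (hH (by omega) hr)

theorem finite_stabilizer_coset (hfin : ∀ n, Finite (H n)) (v : Σ n, G ⧸ H n) :
    Finite (MulAction.stabilizer G v) := by
  obtain ⟨n, x⟩ := v
  induction x using QuotientGroup.induction_on with | H a
  have hmem : ∀ g ∈ MulAction.stabilizer G (⟨n, (a : G ⧸ H n)⟩ : Σ n, G ⧸ H n),
      a⁻¹ * g * a ∈ H n := by
    intro g hg
    have h : ((g * a : G) : G ⧸ H n) = a := eq_of_heq (Sigma.mk.inj hg).2
    simpa [mul_assoc] using QuotientGroup.eq.1 h.symm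
  have := hfin n
  refine Finite.of_injective (fun g => (⟨a⁻¹ * g.1 * a, hmem g.1 g.2⟩ : H n)) fun g h hgh => ?_
  exact Subtype.ext (mul_left_cancel (mul_right_cancel (Subtype.mk.inj hgh)))

end CosetTree

/-- Every countable locally finite group acts on a tree with finite vertex
stabilizers. -/
theorem locally_finite_acts_on_tree (G : Type) [Group G] [Countable G]
    (hLF : ∀ H : Subgroup G, H.FG → Finite H) :
    ∃ (V : Type) (inst : MulAction G V) (T : SimpleGraph V),
      @IsGTree G _ V inst T ∧
      ∀ v : V, Finite (@MulAction.stabilizer G V _ inst v) := by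
  obtain ⟨H, hH, hfin, hG⟩ := exists_monotone_finite_subgroups G hLF
  have hp : ∀ v : Σ n, G ⧸ H n, (cosetParent hH v).1 = v.1 + 1 := fun _ => rfl
  have : Nonempty (Σ n, G ⧸ H n) := ⟨⟨0, ((1 : G) : G ⧸ H 0)⟩⟩
  refine ⟨Σ n, G ⧸ H n, inferInstance, parentGraph (cosetParent hH), ?_,
    finite_stabilizer_coset hfin⟩
  refine ⟨parentGraph_isTree hp (exists_iterate_cosetParent_eq hH hG), fun g u v h => ?_, ?_⟩
  · rw [parentGraph_adj_iff hp] at h ⊢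
    simpa only [cosetParent_smul, smul_left_cancel_iff] using h
  · rintro g u v h ⟨rfl, -⟩
    have hlevel : (g • u).1 = u.1 := rfl
    rcases (parentGraph_adj_iff hp).1 h with h | h
    · have := hp u
      rw [h] at this
      omega
    · have := hp (g • u)
      rw [h] at this
      omega
end
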